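/- arXiv:1701.02827 — 2 statements merged into one kernel-verified Lean document; each statement's English description precedes it below -/
import Mathlib

section
/- For any pair of jointly distributed random variables (X,Y) taking values in a Polish space with Borel probability measure, if the mutual information I(X;Y) is finite, then there exists a random variable Z such that Z is independent of X, Y is almost surely equal to a measurable function g(X,Z) of X and Z, and the conditional mutual information satisfies I(X;Z|Y) ≤ log₂(I(X;Y)+1) + 4 bits. -/
open MeasureTheory ProbabilityTheory Real
open scoped ENNReal

noncomputable section
open Classical in

/-- Kullback–Leibler divergence in bits (base-2 logarithm). -/
def klBits {α : Type*} [MeasurableSpace α] (P Q : Measure α) : ℝ≥0∞ :=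
  if P ≪ Q ∧ Integrable (fun x => Real.logb 2 (P.rnDeriv Q x).toReal) P
  then ENNReal.ofReal (∫ x, Real.logb 2 (P.rnDeriv Q x).toReal ∂P)
  else ⊤

/-- Mutual information `I(X;Y)` in bits: the KL divergence between the joint law and the
product of the marginal laws. -/
def miBits {Ω 𝒳 𝒴 : Type*} [MeasurableSpace Ω] [MeasurableSpace 𝒳] [MeasurableSpace 𝒴]
    (μ : Measure Ω) (X : Ω → 𝒳) (Y : Ω → 𝒴) : ℝ≥0∞ :=
  klBits (μ.map (fun ω => (X ω, Y ω))) ((μ.map X).prod (μ.map Y))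

/-- Conditional mutual information `I(X;Z|Y)` in bits, defined via the chain rule
`I(X;Z|Y) = I(X;(Z,Y)) - I(X;Y)`. -/
def cmiBits {Ω 𝒳 𝒵 𝒴 : Type*} [MeasurableSpace Ω] [MeasurableSpace 𝒳] [MeasurableSpace 𝒵]
    [MeasurableSpace 𝒴] (μ : Measure Ω) (X : Ω → 𝒳) (Z : Ω → 𝒵) (Y : Ω → 𝒴) : ℝ≥0∞ :=
  miBits μ X (fun ω => (Z ω, Y ω)) - miBits μ X Y

/-- Entropy `H(X)` in bits, as `I(X;X)` (equals the Shannon entropy for discrete `X`,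
and `∞` otherwise). -/
def entBits {Ω 𝒳 : Type*} [MeasurableSpace Ω] [MeasurableSpace 𝒳]
    (μ : Measure Ω) (X : Ω → 𝒳) : ℝ≥0∞ :=
  miBits μ X X

/-- Conditional entropy `H(Y|Z)` in bits, as `I(Y;Y|Z)`. -/
def condEntBits {Ω 𝒴 𝒵 : Type*} [MeasurableSpace Ω] [MeasurableSpace 𝒴] [MeasurableSpace 𝒵]
    (μ : Measure Ω) (Y : Ω → 𝒴) (Z : Ω → 𝒵) : ℝ≥0∞ :=
  cmiBits μ Y Y Z

/-- Mutual information of a joint distribution on a product space. -/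
def miOfJoint {𝒳 𝒴 : Type*} [MeasurableSpace 𝒳] [MeasurableSpace 𝒴]
    (ν : Measure (𝒳 × 𝒴)) : ℝ≥0∞ :=
  miBits ν Prod.fst Prod.snd

set_option linter.unusedSectionVars false

theorem zeta_step (a : ℝ) (ha : 0 < a) (n : ℕ) :
    ((n:ℝ) + 2) ^ (-(1 + a)) ≤ (((n:ℝ) + 1) ^ (-a) - ((n:ℝ) + 2) ^ (-a)) / a := by
  have h1 : (0:ℝ) < (n:ℝ) + 1 := by positivity
  have h2 : (0:ℝ) < (n:ℝ) + 2 := by positivity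
  have e1 : ((n:ℝ) + 1) ^ (-a) = ((n:ℝ) + 2) ^ (-a) * (((n:ℝ)+2)/((n:ℝ)+1)) ^ a := by
    rw [Real.div_rpow h2.le h1.le, Real.rpow_neg h1.le, Real.rpow_neg h2.le]
    have := Real.rpow_pos_of_pos h1 a
    have := Real.rpow_pos_of_pos h2 a
    field_simp
  have e2 : ((n:ℝ) + 2) ^ (-(1 + a)) = ((n:ℝ) + 2) ^ (-a) * (1 / ((n:ℝ)+2)) := by
    rw [show -(1+a) = -a + (-1) by ring, Real.rpow_add h2, Real.rpow_neg_one]; simp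
  have e3 : 1 + a * (1 / ((n:ℝ)+2)) ≤ (((n:ℝ)+2)/((n:ℝ)+1)) ^ a := by
    have hp : 0 < ((n:ℝ)+2)/((n:ℝ)+1) := by positivity
    rw [Real.rpow_def_of_pos hp]
    have hl := Real.one_sub_inv_le_log_of_pos hp
    have : 1 - (((n:ℝ)+2)/((n:ℝ)+1))⁻¹ = 1 / ((n:ℝ)+2) := by field_simp; ring
    rw [this] at hl
    have h3 := Real.add_one_le_exp (Real.log (((n:ℝ)+2)/((n:ℝ)+1)) * a)
    nlinarith
  rw [e1, e2, le_div_iff₀ ha]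
  have := Real.rpow_pos_of_pos h2 (-a)
  nlinarith

theorem zeta_bound (a : ℝ) (ha : 0 < a) (N : ℕ) :
    ∑ n ∈ Finset.range N, ((n:ℝ) + 1) ^ (-(1 + a)) ≤ 1 + 1 / a := by
  have key : ∀ N : ℕ, ∑ n ∈ Finset.range (N+1), ((n:ℝ) + 1) ^ (-(1 + a))
      ≤ 1 + (1 - ((N:ℝ) + 1) ^ (-a)) / a := by
    intro N
    induction N with
    | zero => simp
    | succ k ih =>
      rw [Finset.sum_range_succ]
      have := zeta_step a ha k
      push_cast
      rw [show (k:ℝ) + 1 + 1 = k + 2 by ring]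
      have e : (1 - ((k:ℝ) + 2) ^ (-a)) / a = (1 - ((k:ℝ) + 1) ^ (-a)) / a +
        (((k:ℝ) + 1) ^ (-a) - ((k:ℝ) + 2) ^ (-a)) / a := by ring
      linarith
  cases N with
  | zero => simp; positivity
  | succ k =>
    refine (key k).trans ?_
    have : 0 < ((k:ℝ) + 1) ^ (-a) := Real.rpow_pos_of_pos (by positivity) _
    gcongr; linarith

/-- The code distribution. -/
def qw (B : ℝ) (n : ℕ) : ℝ := (1 + B)⁻¹ * ((n:ℝ) + 1) ^ (-(1 + B⁻¹))

theorem qw_pos {B : ℝ} (hB : 0 < B) (n : ℕ) : 0 < qw B n := by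
  unfold qw
  have : 0 < ((n:ℝ) + 1) ^ (-(1 + B⁻¹)) := Real.rpow_pos_of_pos (by positivity) _
  positivity

theorem qw_sum {B : ℝ} (hB : 0 < B) : ∑' n, ENNReal.ofReal (qw B n) ≤ 1 := by
  rw [ENNReal.tsum_eq_iSup_nat]
  refine iSup_le fun N => ?_
  rw [← ENNReal.ofReal_sum_of_nonneg (fun n _ => (qw_pos hB n).le)]
  rw [← ENNReal.ofReal_one]
  apply ENNReal.ofReal_le_ofReal
  unfold qw
  rw [← Finset.mul_sum]
  have := zeta_bound B⁻¹ (by positivity) N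
  rw [inv_mul_le_iff₀ (by positivity)]
  simpa using this

theorem qw_log {B : ℝ} (hB : 0 < B) (n : ℕ) :
    - Real.logb 2 (qw B n) = (1 + B⁻¹) / Real.log 2 * Real.log ((n:ℝ)+1) + Real.logb 2 (1 + B) := by
  unfold qw
  have : 0 < ((n:ℝ) + 1) ^ (-(1 + B⁻¹)) := Real.rpow_pos_of_pos (by positivity) _
  rw [Real.logb_mul (by positivity) this.ne', Real.logb_inv, Real.logb_rpow_eq_mul_logb_of_pos (by positivity)]
  unfold Real.logb
  ring

/-- final numeric estimate -/
theorem numeric (I : ℝ) (hI : 0 ≤ I) :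
    (1 + (I + 1 / Real.log 2)⁻¹) / Real.log 2 * (I * Real.log 2 + 1)
      + Real.logb 2 (1 + (I + 1 / Real.log 2)) ≤ I + (Real.logb 2 (I + 1) + 4) := by
  have hl : 0.69 < Real.log 2 := by have := Real.log_two_gt_d9; linarith
  set c := 1 / Real.log 2 with hc
  have hc0 : 0 < c := by positivity
  have hc1 : c ≤ 1.5 := by rw [hc, div_le_iff₀ (by linarith)]; linarith
  have e1 : (1 + (I + c)⁻¹) / Real.log 2 * (I * Real.log 2 + 1) = I + c + 1 := by
    have h : I * Real.log 2 + 1 = (I + c) * Real.log 2 := by rw [hc]; field_simp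
    rw [h]
    have : I + c ≠ 0 := by positivity
    have : Real.log 2 ≠ 0 := by positivity
    field_simp
  rw [e1]
  have e2 : Real.logb 2 (1 + (I + c)) ≤ Real.logb 2 (I+1) + 1.5 := by
    have h5 : Real.logb 2 (2.5:ℝ) ≤ 1.5 := by
      rw [Real.logb_le_iff_le_rpow (by norm_num) (by norm_num)]
      apply le_of_sq_le_sq _ (by positivity) |> fun h => h
      rw [← Real.rpow_natCast, ← Real.rpow_natCast, ← Real.rpow_mul (by norm_num)]
      norm_num
    calc _ ≤ Real.logb 2 ((I+1) * 2.5) := by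
          apply Real.logb_le_logb_of_le (by norm_num) (by positivity); linarith
      _ = Real.logb 2 (I+1) + Real.logb 2 2.5 := by
          rw [Real.logb_mul (by positivity) (by norm_num)]
      _ ≤ _ := by linarith
  linarith

/-- Excess mass above level `t`. -/
def psi {𝒴 : Type*} [MeasurableSpace 𝒴] (Q : Measure 𝒴) (f : 𝒴 → ℝ) (t : ℝ) : ℝ :=
  ∫ y, max (f y - t) 0 ∂Q

/-- The levels of greedy rejection sampling. -/
def slev {𝒴 : Type*} [MeasurableSpace 𝒴] (Q : Measure 𝒴) (f : 𝒴 → ℝ) : ℕ → ℝ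
  | 0 => 0
  | n + 1 => slev Q f n + psi Q f (slev Q f n)

section OneD
variable {𝒴 : Type*} [MeasurableSpace 𝒴] {Q : Measure 𝒴} [IsProbabilityMeasure Q] {f : 𝒴 → ℝ}

theorem psi_integrable (hi : Integrable f Q) (t : ℝ) :
    Integrable (fun y => max (f y - t) 0) Q :=
  (hi.sub (integrable_const t)).pos_part

theorem psi_nonneg (t : ℝ) : 0 ≤ psi Q f t := integral_nonneg fun _ => le_max_right _ _

theorem psi_anti (hi : Integrable f Q) : Antitone (psi Q f) := by
  intro a b hab
  refine integral_mono (psi_integrable hi b) (psi_integrable hi a) fun y => ?_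
  exact max_le_max (by linarith) le_rfl

theorem psi_lip (hi : Integrable f Q) {a b : ℝ} (hab : a ≤ b) :
    psi Q f a ≤ psi Q f b + (b - a) := by
  have : psi Q f b + (b - a) = ∫ y, (max (f y - b) 0 + (b - a)) ∂Q := by
    rw [integral_add (psi_integrable hi b) (integrable_const _)]; simp [psi]
  rw [this]
  refine integral_mono (psi_integrable hi a) ((psi_integrable hi b).add (integrable_const _))
    fun y => ?_
  refine max_le ?_ ?_
  · have := le_max_left (f y - b) 0; simp only; linarith
  · have := le_max_right (f y - b) 0; simp only; linarith

theorem psi_cont (hi : Integrable f Q) : Continuous (psi Q f) := by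
  have : LipschitzWith 1 (psi Q f) := by
    apply LipschitzWith.of_le_add
    intro a b
    rcases le_total a b with h | h
    · have := psi_lip hi h
      rw [Real.dist_eq, abs_sub_comm, abs_of_nonneg (by linarith)]; exact this
    · have := psi_anti hi h
      have := dist_nonneg (x := a) (y := b)
      linarith
  exact this.continuous

theorem psi_zero (h0 : ∀ y, 0 ≤ f y) (h1 : ∫ y, f y ∂Q = 1) : psi Q f 0 = 1 := by
  unfold psi; rw [← h1]; congr 1; ext y; simp [h0 y]

theorem psi_tendsto (hi : Integrable f Q) : Filter.Tendsto (psi Q f) Filter.atTop (nhds 0) := by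
  have : (0:ℝ) = ∫ y, (0:ℝ) ∂Q := by simp
  rw [this]
  refine tendsto_integral_filter_of_dominated_convergence (fun y => |f y|) ?_ ?_ hi.abs ?_
  · exact Filter.Eventually.of_forall fun t => (psi_integrable hi t).aestronglyMeasurable
  · filter_upwards [Filter.eventually_ge_atTop 0] with t ht
    refine Filter.Eventually.of_forall fun y => ?_
    rw [Real.norm_of_nonneg (le_max_right _ _)]
    exact max_le (by have := le_abs_self (f y); linarith) (abs_nonneg _)
  · refine Filter.Eventually.of_forall fun y => ?_
    refine tendsto_const_nhds.congr' ?_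
    filter_upwards [Filter.eventually_ge_atTop (f y)] with t ht
    exact (max_eq_right (by linarith)).symm

theorem slev_mono : Monotone (slev Q f) :=
  monotone_nat_of_le_succ fun n => by
    have := psi_nonneg (Q := Q) (f := f) (slev Q f n)
    simp only [slev]; linarith

theorem slev_nonneg (n : ℕ) : 0 ≤ slev Q f n := slev_mono (Nat.zero_le n)

theorem slev_ge (hi : Integrable f Q) (n : ℕ) : n * psi Q f (slev Q f n) ≤ slev Q f n := by
  induction n with
  | zero => simp [slev]
  | succ k ih =>
    have h := psi_anti hi (slev_mono (Q := Q) (f := f) (Nat.le_succ k))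
    have : slev Q f (k+1) = slev Q f k + psi Q f (slev Q f k) := rfl
    push_cast
    simp only [Nat.succ_eq_add_one] at h
    have hk : (0:ℝ) ≤ k := by positivity
    nlinarith

theorem psi_slev_tendsto (hi : Integrable f Q) :
    Filter.Tendsto (fun n => psi Q f (slev Q f n)) Filter.atTop (nhds 0) := by
  have han : Antitone (fun n => psi Q f (slev Q f n)) := (psi_anti hi).comp_monotone slev_mono
  have hbd : BddBelow (Set.range fun n => psi Q f (slev Q f n)) :=
    ⟨0, by rintro _ ⟨n, rfl⟩; exact psi_nonneg _⟩
  have ht := tendsto_atTop_ciInf han hbd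
  set l := ⨅ n, psi Q f (slev Q f n) with hl
  have hl0 : 0 ≤ l := le_ciInf fun n => psi_nonneg _
  rcases hl0.eq_or_lt with h | h
  · rw [h]; exact ht
  · exfalso
    have hs : Filter.Tendsto (slev Q f) Filter.atTop Filter.atTop := by
      refine Filter.tendsto_atTop_mono (f := fun n : ℕ => (n:ℝ) * l) (fun n => ?_) ?_
      · refine le_trans ?_ (slev_ge hi n)
        exact mul_le_mul_of_nonneg_left (ciInf_le hbd n) (by positivity)
      · exact tendsto_natCast_atTop_atTop.atTop_mul_const h
    have := tendsto_nhds_unique ht ((psi_tendsto hi).comp hs)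
    linarith

/-- Uniform measure under the graph of `f`. -/
def kap (Q : Measure 𝒴) (f : 𝒴 → ℝ) : Measure (𝒴 × ℝ) :=
  (Q.prod volume).restrict {p | 0 < p.2 ∧ p.2 < f p.1}

theorem region_meas (hf : Measurable f) : MeasurableSet {p : 𝒴 × ℝ | 0 < p.2 ∧ p.2 < f p.1} :=
  (measurableSet_lt measurable_const measurable_snd).inter
    (measurableSet_lt measurable_snd (hf.comp measurable_fst))

theorem lintegral_kap (hf : Measurable f) {g : 𝒴 × ℝ → ℝ≥0∞} (hg : Measurable g) :
    ∫⁻ p, g p ∂(kap Q f) = ∫⁻ y, (∫⁻ t in Set.Ioo 0 (f y), g (y, t)) ∂Q := by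
  unfold kap
  rw [← lintegral_indicator (region_meas hf),
    lintegral_prod _ (hg.indicator (region_meas hf)).aemeasurable]
  refine lintegral_congr fun y => ?_
  rw [← lintegral_indicator measurableSet_Ioo]
  rfl

theorem integral_kap (hf : Measurable f) {g : 𝒴 × ℝ → ℝ} (hg : Integrable g (kap Q f)) :
    ∫ p, g p ∂(kap Q f) = ∫ y, (∫ t in Set.Ioo 0 (f y), g (y, t)) ∂Q := by
  unfold kap at *
  rw [← integral_indicator (region_meas hf),
    integral_prod _ ((integrable_indicator_iff (region_meas hf)).2 hg)]
  refine integral_congr_ae (Filter.Eventually.of_forall fun y => ?_)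
  simp only
  rw [← integral_indicator measurableSet_Ioo]
  rfl

theorem kap_Ioi (hf : Measurable f) (hi : Integrable f Q) {a : ℝ} (ha : 0 ≤ a) :
    kap Q f {p | a < p.2} = ENNReal.ofReal (psi Q f a) := by
  have hm : MeasurableSet {p : 𝒴 × ℝ | a < p.2} := measurableSet_lt measurable_const measurable_snd
  rw [← lintegral_indicator_one hm, lintegral_kap hf (measurable_one.indicator hm), psi,
    ofReal_integral_eq_lintegral_ofReal (psi_integrable hi a)
      (Filter.Eventually.of_forall fun y => le_max_right _ _)]
  refine lintegral_congr fun y => ?_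
  have : (fun t => ({p : 𝒴 × ℝ | a < p.2}.indicator (1 : 𝒴 × ℝ → ℝ≥0∞) (y, t)))
      = (Set.Ioi a).indicator 1 := by
    ext t; rfl
  rw [this, lintegral_indicator_one measurableSet_Ioi, Measure.restrict_apply measurableSet_Ioi]
  have : Set.Ioi a ∩ Set.Ioo 0 (f y) = Set.Ioo a (f y) := by
    ext t; simp only [Set.mem_inter_iff, Set.mem_Ioi, Set.mem_Ioo]
    constructor
    · rintro ⟨h1, h2, h3⟩; exact ⟨h1, h3⟩
    · rintro ⟨h1, h2⟩; exact ⟨h1, by linarith, h2⟩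
  rw [this, Real.volume_Ioo]
  rcases le_total (f y - a) 0 with h | h
  · rw [max_eq_right h, ENNReal.ofReal_of_nonpos h, ENNReal.ofReal_zero]
  · rw [max_eq_left h]

theorem kap_pos (hf : Measurable f) : ∀ᵐ p ∂(kap Q f), 0 < p.2 := by
  filter_upwards [ae_restrict_mem (region_meas hf)] with p hp using hp.1

theorem kap_univ (hf : Measurable f) (hi : Integrable f Q) (h0 : ∀ y, 0 ≤ f y)
    (h1 : ∫ y, f y ∂Q = 1) : kap Q f Set.univ = 1 := by
  have := kap_Ioi hf hi (le_refl 0)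
  rw [psi_zero h0 h1, ENNReal.ofReal_one] at this
  rw [← this]
  refine measure_congr ?_
  filter_upwards [kap_pos (Q := Q) hf] with p hp
  exact propext ⟨fun _ => hp, fun _ => trivial⟩

theorem lintegral_neg_log_le {α : Type*} [MeasurableSpace α] (P : Measure α)
    {V : α → ℝ} (hV : Measurable V) (hV0 : ∀ᵐ a ∂P, V a ≤ 1)
    (h : ∀ r, 0 < r → r < 1 → P {a | V a < r} ≤ ENNReal.ofReal r)
    (hpos : ∀ᵐ a ∂P, 0 < V a) :
    ∫⁻ a, ENNReal.ofReal (- Real.log (V a)) ∂P ≤ 1 := by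
  rw [lintegral_eq_lintegral_meas_lt P ?_ (show Measurable fun a => -Real.log (V a) from hV.log.neg).aemeasurable]
  · calc _ ≤ ∫⁻ t in Set.Ioi (0:ℝ), ENNReal.ofReal (Real.exp (-t)) := by
          refine setLIntegral_mono' measurableSet_Ioi fun t ht => ?_
          have ht : 0 < t := ht
          refine le_trans ?_ (h (Real.exp (-t)) (Real.exp_pos _) (by rw [Real.exp_lt_one_iff]; linarith))
          refine measure_mono_ae ?_
          filter_upwards [hpos] with a ha
          intro (h : t < -Real.log (V a))
          change V a < Real.exp (-t)
          rw [← Real.log_lt_iff_lt_exp ha]; linarith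
      _ = 1 := by
          rw [← ofReal_integral_eq_lintegral_ofReal]
          · rw [integral_exp_neg_Ioi]; simp
          · exact integrableOn_exp_neg_Ioi 0
          · exact Filter.Eventually.of_forall fun t => (Real.exp_pos _).le
  · filter_upwards [hpos, hV0] with a ha ha1
    have := Real.log_nonpos ha.le ha1
    simp only [Pi.zero_apply]; linarith

theorem exists_psi_eq (hi : Integrable f Q) (h0 : ∀ y, 0 ≤ f y)
    (h1 : ∫ y, f y ∂Q = 1) {r : ℝ} (hr : 0 < r) (hr1 : r < 1) : ∃ a, 0 ≤ a ∧ psi Q f a = r := by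
  obtain ⟨b, hb, hb0⟩ := (((psi_tendsto hi).eventually_lt_const hr).and
    (Filter.eventually_ge_atTop 0)).exists
  have := intermediate_value_Icc' hb0 (psi_cont hi).continuousOn
  obtain ⟨a, ha, hae⟩ := this ⟨hb.le, by rw [psi_zero h0 h1]; exact hr1.le⟩
  exact ⟨a, ha.1, hae⟩

theorem kap_psi_lt (hf : Measurable f) (hi : Integrable f Q) (h0 : ∀ y, 0 ≤ f y)
    (h1 : ∫ y, f y ∂Q = 1) {r : ℝ} (hr : 0 < r) (hr1 : r < 1) :
    kap Q f {p | psi Q f p.2 < r} ≤ ENNReal.ofReal r := by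
  obtain ⟨a, ha, hae⟩ := exists_psi_eq hi h0 h1 hr hr1
  rw [← hae, ← kap_Ioi hf hi ha]
  refine measure_mono fun p hp => ?_
  by_contra hcon
  have := psi_anti hi (not_lt.1 hcon)
  exact absurd hp (not_lt.2 this)

theorem kap_psi_gt (hf : Measurable f) (hi : Integrable f Q) (h0 : ∀ y, 0 ≤ f y)
    (h1 : ∫ y, f y ∂Q = 1) {r : ℝ} (hr : 0 < r) (hr1 : r < 1) :
    kap Q f {p | 1 - psi Q f p.2 < r} ≤ ENNReal.ofReal r := by
  obtain ⟨a, ha, hae⟩ := exists_psi_eq hi h0 h1 (r := 1 - r) (by linarith) (by linarith)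
  have hm : MeasurableSet {p : 𝒴 × ℝ | a < p.2} := measurableSet_lt measurable_const measurable_snd
  have hsub : {p : 𝒴 × ℝ | 1 - psi Q f p.2 < r} ⊆ {p : 𝒴 × ℝ | a < p.2}ᶜ := by
    intro p hp hcon
    have hcon : a < p.2 := hcon
    have hp : 1 - psi Q f p.2 < r := hp
    have := psi_anti hi hcon.le
    linarith
  refine (measure_mono hsub).trans ?_
  have hu := kap_univ hf hi h0 h1
  rw [measure_compl hm (by rw [kap_Ioi hf hi ha]; exact ENNReal.ofReal_ne_top), hu,
    kap_Ioi hf hi ha, hae, ← ENNReal.ofReal_one, ← ENNReal.ofReal_sub _ (by linarith)]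
  simp

theorem psi_le_one (hi : Integrable f Q) (h0 : ∀ y, 0 ≤ f y)
    (h1 : ∫ y, f y ∂Q = 1) {t : ℝ} (ht : 0 ≤ t) : psi Q f t ≤ 1 := by
  rw [← psi_zero h0 h1]; exact psi_anti hi ht

theorem null_of_lt {α : Type*} [MeasurableSpace α] (P : Measure α) {V : α → ℝ}
    (h : ∀ r, 0 < r → r < 1 → P {a | V a < r} ≤ ENNReal.ofReal r) : ∀ᵐ a ∂P, 0 < V a := by
  rw [ae_iff]
  refine le_antisymm ?_ zero_le
  refine ENNReal.le_of_forall_pos_le_add fun ε hε _ => ?_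
  have hm : (0:ℝ) < min (ε:ℝ) (1/2) := lt_min (by exact_mod_cast hε) (by norm_num)
  have := h (min ε (1/2)) hm (lt_of_le_of_lt (min_le_right _ _) (by norm_num))
  rw [zero_add]
  calc _ ≤ P {a | V a < min (ε:ℝ) (1/2)} := measure_mono fun a ha => by
        have ha : ¬ 0 < V a := ha
        change V a < _
        linarith
    _ ≤ _ := this
    _ ≤ ENNReal.ofReal ε := ENNReal.ofReal_le_ofReal (min_le_left _ _)
    _ = ε := by simp

theorem kap_psi_pos (hf : Measurable f) (hi : Integrable f Q) (h0 : ∀ y, 0 ≤ f y)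
    (h1 : ∫ y, f y ∂Q = 1) : ∀ᵐ p ∂(kap Q f), 0 < psi Q f p.2 :=
  null_of_lt _ fun _ hr hr1 => kap_psi_lt hf hi h0 h1 hr hr1

theorem kap_psi_lt_one (hf : Measurable f) (hi : Integrable f Q) (h0 : ∀ y, 0 ≤ f y)
    (h1 : ∫ y, f y ∂Q = 1) : ∀ᵐ p ∂(kap Q f), 0 < 1 - psi Q f p.2 :=
  null_of_lt _ fun _ hr hr1 => kap_psi_gt hf hi h0 h1 hr hr1

end OneD

section OneD
variable {𝒴 : Type*} [MeasurableSpace 𝒴] {Q : Measure 𝒴} [IsProbabilityMeasure Q] {f : 𝒴 → ℝ}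

theorem int_of_lint {α : Type*} [MeasurableSpace α] {P : Measure α} {h : α → ℝ}
    (hm : Measurable h) (h0 : ∀ᵐ a ∂P, 0 ≤ h a) (hl : ∫⁻ a, ENNReal.ofReal (h a) ∂P ≤ 1) :
    Integrable h P ∧ ∫ a, h a ∂P ≤ 1 := by
  constructor
  · refine ⟨hm.aestronglyMeasurable, ?_⟩
    rw [hasFiniteIntegral_iff_ofReal h0]
    exact hl.trans_lt ENNReal.one_lt_top
  · rw [integral_eq_lintegral_of_nonneg_ae h0 hm.aestronglyMeasurable]
    exact ENNReal.toReal_le_of_le_ofReal zero_le_one (by simpa using hl)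

theorem kap_slot (hf : Measurable f) (hi : Integrable f Q) (n : ℕ) :
    kap Q f {p | slev Q f n < p.2 ∧ p.2 ≤ slev Q f (n+1)} =
      ENNReal.ofReal (psi Q f (slev Q f n) - psi Q f (slev Q f (n+1))) := by
  have hm : MeasurableSet {p : 𝒴 × ℝ | slev Q f (n+1) < p.2} :=
    measurableSet_lt measurable_const measurable_snd
  have hle : slev Q f n ≤ slev Q f (n+1) := slev_mono (Nat.le_succ n)
  rw [ENNReal.ofReal_sub _ (psi_nonneg _), ← kap_Ioi hf hi (slev_nonneg n),
    ← kap_Ioi hf hi (slev_nonneg (n+1)), ← measure_sdiff]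
  · congr 1; ext p; simp
  · intro p hp; exact hle.trans_lt hp
  · exact hm.nullMeasurableSet
  · rw [kap_Ioi hf hi (slev_nonneg (n+1))]; exact ENNReal.ofReal_ne_top

theorem log_bound (hf : Measurable f) (hi : Integrable f Q) (h0 : ∀ y, 0 ≤ f y)
    (h1 : ∫ y, f y ∂Q = 1) (hfl : Integrable (fun y => f y * Real.log (f y)) Q) :
    0 ≤ (∫ y, f y * Real.log (f y) ∂Q) + 1 ∧
    ∑' n : ℕ, ENNReal.ofReal (Real.log ((n:ℝ) + 1)) *
      ENNReal.ofReal (psi Q f (slev Q f n) - psi Q f (slev Q f (n+1))) ≤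
      ENNReal.ofReal ((∫ y, f y * Real.log (f y) ∂Q) + 1) := by
  have hpm : Measurable fun p : 𝒴 × ℝ => psi Q f p.2 :=
    (psi_cont hi).measurable.comp measurable_snd
  have hpm' : Measurable fun p : 𝒴 × ℝ => 1 - psi Q f p.2 := measurable_const.sub hpm
  have p1 := kap_psi_pos hf hi h0 h1
  have p2 := kap_psi_lt_one hf hi h0 h1
  have p0 := kap_pos (Q := Q) hf
  have a1 : ∀ᵐ p ∂(kap Q f), psi Q f p.2 ≤ 1 := by
    filter_upwards [p0] with p hp using psi_le_one hi h0 h1 hp.le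
  have a2 : ∀ᵐ p ∂(kap Q f), 1 - psi Q f p.2 ≤ 1 :=
    Filter.Eventually.of_forall fun p => by have := psi_nonneg (Q := Q) (f := f) p.2; linarith
  obtain ⟨i1, l1⟩ := int_of_lint (P := kap Q f) (h := fun p => - Real.log (psi Q f p.2)) hpm.log.neg
    (by filter_upwards [p1, a1] with p hp hp1
        have := Real.log_nonpos hp.le hp1; linarith)
    (lintegral_neg_log_le _ hpm a1 (fun r hr hr1 => kap_psi_lt hf hi h0 h1 hr hr1) p1)
  obtain ⟨i2, l2⟩ := int_of_lint (P := kap Q f) (h := fun p => - Real.log (1 - psi Q f p.2))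
    hpm'.log.neg
    (by filter_upwards [p2, a2] with p hp hp1
        have := Real.log_nonpos hp.le hp1; linarith)
    (lintegral_neg_log_le _ hpm' a2 (fun r hr hr1 => kap_psi_gt hf hi h0 h1 hr hr1) p2)
  -- t ≥ 1 - ψ(t)
  have hge : ∀ t, 0 ≤ t → 1 - psi Q f t ≤ t := fun t ht => by
    have := psi_lip hi ht
    rw [psi_zero h0 h1] at this; linarith
  -- integrability of log t
  have ip : Integrable (fun p : 𝒴 × ℝ => max (Real.log (f p.1)) 0) (kap Q f) := by
    have hmm : Measurable fun p : 𝒴 × ℝ => max (Real.log (f p.1)) 0 :=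
      ((hf.comp measurable_fst).log).max measurable_const
    refine ⟨hmm.aestronglyMeasurable, ?_⟩
    have hnn : 0 ≤ᵐ[kap Q f] fun p : 𝒴 × ℝ => max (Real.log (f p.1)) 0 :=
      Filter.Eventually.of_forall fun p => le_max_right _ _
    rw [hasFiniteIntegral_iff_ofReal hnn, lintegral_kap hf hmm.ennreal_ofReal]
    have : ∀ y, (∫⁻ t in Set.Ioo 0 (f y), ENNReal.ofReal (max (Real.log (f y)) 0)) =
        ENNReal.ofReal (max (f y * Real.log (f y)) 0) := by
      intro y
      rw [setLIntegral_const, Real.volume_Ioo, ← ENNReal.ofReal_mul (le_max_right _ _), sub_zero,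
        mul_comm, mul_max_of_nonneg _ _ (h0 y), mul_zero]
    simp only [this]
    have hnn' : 0 ≤ᵐ[Q] fun y => max (f y * Real.log (f y)) 0 :=
      Filter.Eventually.of_forall fun p => le_max_right _ _
    exact (hasFiniteIntegral_iff_ofReal hnn').1 hfl.pos_part.2
  have il : Integrable (fun p : 𝒴 × ℝ => Real.log p.2) (kap Q f) := by
    refine (ip.add i2).mono' (Real.measurable_log.comp measurable_snd).aestronglyMeasurable ?_
    filter_upwards [ae_restrict_mem (region_meas hf), p2] with p hp hp2
    have hpp : 0 < p.2 := hp.1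
    have b1 : Real.log p.2 ≤ max (Real.log (f p.1)) 0 :=
      (Real.log_le_log hpp hp.2.le).trans (le_max_left _ _)
    have b2 : Real.log (1 - psi Q f p.2) ≤ Real.log p.2 := Real.log_le_log hp2 (hge _ hpp.le)
    have b3 := le_max_right (Real.log (f p.1)) 0
    have b4 : Real.log (1 - psi Q f p.2) ≤ 0 :=
      Real.log_nonpos hp2.le (by have := psi_nonneg (Q := Q) (f := f) p.2; linarith)
    simp only [Pi.add_apply, Real.norm_eq_abs]
    rw [abs_le]
    constructor <;> linarith
  have el : ∫ p, Real.log p.2 ∂(kap Q f) = (∫ y, f y * Real.log (f y) ∂Q) - 1 := by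
    rw [integral_kap hf il, ← h1, ← integral_sub hfl hi]
    refine integral_congr_ae (Filter.Eventually.of_forall fun y => ?_)
    simp only
    rw [← integral_Ioc_eq_integral_Ioo, ← intervalIntegral.integral_of_le (h0 y), integral_log]
    simp
  -- the dominating function
  set g : 𝒴 × ℝ → ℝ := fun p =>
    Real.log p.2 + (- Real.log (psi Q f p.2)) + (- Real.log (1 - psi Q f p.2)) with hg
  have ig : Integrable g (kap Q f) := (il.add i1).add i2
  have g0 : 0 ≤ᵐ[kap Q f] g := by
    filter_upwards [p0, p1, p2, a1] with p hp hp1 hp2 ha1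
    have b2 : Real.log (1 - psi Q f p.2) ≤ Real.log p.2 := Real.log_le_log hp2 (hge _ hp.le)
    have b3 := Real.log_nonpos hp1.le ha1
    simp only [Pi.zero_apply, hg]; linarith
  have eg : ∫ p, g p ∂(kap Q f) ≤ (∫ y, f y * Real.log (f y) ∂Q) + 1 := by
    have : ∫ p, g p ∂(kap Q f) = ∫ p, Real.log p.2 ∂(kap Q f) +
        ∫ p, - Real.log (psi Q f p.2) ∂(kap Q f) + ∫ p, - Real.log (1 - psi Q f p.2) ∂(kap Q f) := by
      rw [← integral_add il i1]
      exact integral_add (il.add i1) i2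
    rw [this, el]; linarith
  refine ⟨(integral_nonneg_of_ae g0).trans eg, ?_⟩
  have hms : ∀ n, MeasurableSet {p : 𝒴 × ℝ | slev Q f n < p.2 ∧ p.2 ≤ slev Q f (n+1)} := fun n =>
    (measurableSet_lt measurable_const measurable_snd).inter
      (measurableSet_le measurable_snd measurable_const)
  have hdis : Pairwise (Function.onFun Disjoint fun n : ℕ =>
      {p : 𝒴 × ℝ | slev Q f n < p.2 ∧ p.2 ≤ slev Q f (n+1)}) := by
    intro m n hmn
    rw [Function.onFun, Set.disjoint_left]
    rintro p ⟨hm1, hm2⟩ ⟨hn1, hn2⟩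
    rcases lt_or_gt_of_ne hmn with h | h
    · have := slev_mono (Q := Q) (f := f) (Nat.succ_le_of_lt h)
      simp only [Nat.succ_eq_add_one] at this
      linarith
    · have := slev_mono (Q := Q) (f := f) (Nat.succ_le_of_lt h)
      simp only [Nat.succ_eq_add_one] at this
      linarith
  calc _ ≤ ∑' n : ℕ, ∫⁻ p in {p : 𝒴 × ℝ | slev Q f n < p.2 ∧ p.2 ≤ slev Q f (n+1)},
        ENNReal.ofReal (g p) ∂(kap Q f) := by
        refine ENNReal.tsum_le_tsum fun n => ?_
        rw [← kap_slot hf hi n, ← setLIntegral_const]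
        refine setLIntegral_mono_ae' (hms n) ?_
        filter_upwards [p0, p1, p2] with p hp hp1 hp2 hpn
        apply ENNReal.ofReal_le_ofReal
        have hn0 : (0:ℝ) ≤ n := by positivity
        have c1 : n * psi Q f p.2 ≤ p.2 := by
          have := slev_ge (Q := Q) (f := f) hi n
          have hh := psi_anti hi hpn.1.le
          have := hpn.1
          nlinarith
        have c2 := hge _ hp.le
        have : Real.log ((n:ℝ)+1) ≤ Real.log (p.2 / (psi Q f p.2 * (1 - psi Q f p.2))) := by
          apply Real.log_le_log (by positivity)
          rw [le_div_iff₀ (by positivity)]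
          have := mul_le_mul_of_nonneg_right c1 hp2.le
          have := mul_le_mul_of_nonneg_left c2 hp1.le
          nlinarith
        rw [Real.log_div hp.ne' (by positivity), Real.log_mul hp1.ne' hp2.ne'] at this
        simp only [hg]; linarith
    _ = ∫⁻ p in ⋃ n, {p : 𝒴 × ℝ | slev Q f n < p.2 ∧ p.2 ≤ slev Q f (n+1)},
        ENNReal.ofReal (g p) ∂(kap Q f) := (lintegral_iUnion hms hdis _).symm
    _ ≤ ∫⁻ p, ENNReal.ofReal (g p) ∂(kap Q f) := setLIntegral_le_lintegral _ _
    _ = ENNReal.ofReal (∫ p, g p ∂(kap Q f)) := (ofReal_integral_eq_lintegral_ofReal ig g0).symm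
    _ ≤ _ := ENNReal.ofReal_le_ofReal eg
end OneD

theorem measurable_sInf_nat {A : Type*} [MeasurableSpace A] {S : ℕ → Set A}
    (hS : ∀ n, MeasurableSet (S n)) : Measurable fun a => sInf {n | a ∈ S n} := by
  refine measurable_to_countable' fun n => ?_
  have : (fun a => sInf {n | a ∈ S n}) ⁻¹' {n} =
      (S n ∩ ⋂ m ∈ Finset.range n, (S m)ᶜ) ∪ (⋂ m, (S m)ᶜ ∩ {_a | n = 0}) := by
    ext a
    simp only [Set.mem_preimage, Set.mem_singleton_iff, Set.mem_union, Set.mem_inter_iff,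
      Set.mem_iInter, Finset.mem_range, Set.mem_compl_iff, Set.mem_ofPred_eq]
    constructor
    · rintro rfl
      by_cases h : {n | a ∈ S n}.Nonempty
      · left
        exact ⟨Nat.sInf_mem h, fun m hm => Nat.notMem_of_lt_sInf hm⟩
      · right
        rw [Set.not_nonempty_iff_eq_empty] at h
        intro m
        refine ⟨fun hm => ?_, by rw [h]; simp⟩
        have : m ∈ {n | a ∈ S n} := hm
        rw [h] at this; exact this
    · rintro (⟨h1, h2⟩ | h)
      · refine le_antisymm (Nat.sInf_le h1) ?_
        by_contra hlt
        exact h2 _ (not_le.1 hlt) (Nat.sInf_mem (s := {n | a ∈ S n}) ⟨n, h1⟩)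
      · have : {n | a ∈ S n} = ∅ := by
          ext m; simp [(h m).1]
        rw [this, (h 0).2]; simp
  rw [this]
  refine ((hS n).inter ?_).union ?_
  · exact Finset.measurableSet_biInter _ fun m _ => (hS m).compl
  · exact MeasurableSet.iInter fun m => (hS m).compl.inter (MeasurableSet.const _)

/-- acceptance set at step `n` -/
def acc {𝒴 𝒲 : Type*} [MeasurableSpace 𝒴] (Q : Measure 𝒴) (η : 𝒲 → 𝒴) (υ : 𝒲 → ℝ)
    (f : 𝒴 → ℝ) (n : ℕ) : Set 𝒲 :=
  {w | slev Q f n + υ w * psi Q f (slev Q f n) < f (η w)}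

/-- index of the accepted sample -/
def kidx {𝒴 𝒲 : Type*} [MeasurableSpace 𝒴] (Q : Measure 𝒴) (η : 𝒲 → 𝒴) (υ : 𝒲 → ℝ)
    (f : 𝒴 → ℝ) (z : ℕ → 𝒲) : ℕ := sInf {n | z n ∈ acc Q η υ f n}

section Samp
variable {𝒴 𝒲 : Type*} [MeasurableSpace 𝒴] [MeasurableSpace 𝒲] {Q : Measure 𝒴}
  [IsProbabilityMeasure Q] {f : 𝒴 → ℝ} {ν : Measure 𝒲} [IsProbabilityMeasure ν]
  {η : 𝒲 → 𝒴} {υ : 𝒲 → ℝ}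

/-- density accepted in step `n` -/
def dd (Q : Measure 𝒴) (f : 𝒴 → ℝ) (n : ℕ) (y : 𝒴) : ℝ :=
  max (f y - slev Q f n) 0 - max (f y - slev Q f (n+1)) 0

theorem acc_meas (hη : Measurable η) (hυ : Measurable υ) (hf : Measurable f) (n : ℕ) :
    MeasurableSet (acc Q η υ f n) :=
  measurableSet_lt (measurable_const.add (hυ.mul_const _)) (hf.comp hη)

theorem dd_nonneg (n : ℕ) (y : 𝒴) : 0 ≤ dd Q f n y := by
  have : slev Q f n ≤ slev Q f (n+1) := slev_mono (Nat.le_succ n)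
  exact sub_nonneg.2 (max_le_max (by linarith) le_rfl)

theorem acc_prob (hη : Measurable η) (hυ : Measurable υ)
    (hν : ν.map (fun w => (η w, υ w)) = Q.prod (volume.restrict (Set.Ico (0:ℝ) 1)))
    (hf : Measurable f) (n : ℕ) {B : Set 𝒴} (hB : MeasurableSet B) :
    ENNReal.ofReal (psi Q f (slev Q f n)) * ν (acc Q η υ f n ∩ η ⁻¹' B) =
      ∫⁻ y in B, ENNReal.ofReal (dd Q f n y) ∂Q := by
  set s := slev Q f n with hs
  set c := psi Q f s with hc
  have hc0 : 0 ≤ c := psi_nonneg _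
  set E : Set (𝒴 × ℝ) := {p | s + p.2 * c < f p.1} ∩ {p | p.1 ∈ B} with hE
  have hEm : MeasurableSet E := (measurableSet_lt (measurable_const.add (measurable_snd.mul_const _))
    (hf.comp measurable_fst)).inter (measurable_fst hB)
  have e1 : ν (acc Q η υ f n ∩ η ⁻¹' B) = (Q.prod (volume.restrict (Set.Ico (0:ℝ) 1))) E := by
    rw [← hν, Measure.map_apply (hη.prodMk hυ) hEm]; rfl
  rw [e1, Measure.prod_apply hEm, ← lintegral_const_mul' _ _ ENNReal.ofReal_ne_top,
    ← lintegral_indicator hB]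
  refine lintegral_congr fun y => ?_
  have hd : dd Q f n y = min c (max (f y - s) 0) := by
    have : slev Q f (n+1) = s + c := rfl
    simp only [dd, this, ← hs]
    rcases le_total (f y - s) 0 with h | h
    · rw [max_eq_right h, max_eq_right (by linarith), min_eq_right hc0]; simp
    · rw [max_eq_left h]
      rcases le_total (f y - s) c with h' | h'
      · rw [max_eq_right (by linarith), min_eq_right h']; simp
      · rw [max_eq_left (by linarith), min_eq_left h']; ring
  by_cases hy : y ∈ B
  · rw [Set.indicator_of_mem hy, hd, Measure.restrict_apply (measurable_prodMk_left hEm)]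
    rcases hc0.eq_or_lt with h | h
    · rw [← h]; simp
    · have : (Prod.mk y ⁻¹' E) ∩ Set.Ico (0:ℝ) 1 = Set.Ico 0 (min 1 ((f y - s) / c)) := by
        ext u
        simp only [hE, Set.preimage_inter, Set.preimage_ofPred_eq, Set.mem_inter_iff,
          Set.mem_ofPred_eq, Set.mem_Ico, lt_min_iff, lt_div_iff₀ h]
        constructor
        · rintro ⟨⟨h1, -⟩, h2, h3⟩; exact ⟨h2, h3, by linarith⟩
        · rintro ⟨h2, h3, h1⟩; exact ⟨⟨by linarith, hy⟩, h2, h3⟩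
      rw [this, Real.volume_Ico, ← ENNReal.ofReal_mul hc0, sub_zero, mul_min_of_nonneg _ _ hc0,
        mul_one, mul_div_cancel₀ _ h.ne']
      rcases le_total (f y - s) 0 with h' | h'
      · rw [max_eq_right h', min_eq_right hc0, ENNReal.ofReal_zero, ENNReal.ofReal_of_nonpos]
        exact (min_le_right _ _).trans h'
      · rw [max_eq_left h']
  · rw [Set.indicator_of_notMem hy]
    have : Prod.mk y ⁻¹' E = ∅ := by
      ext u; simp [hE, hy]
    rw [this]; simp

theorem dd_integral (hi : Integrable f Q) (n : ℕ) :
    ∫⁻ y, ENNReal.ofReal (dd Q f n y) ∂Q =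
      ENNReal.ofReal (psi Q f (slev Q f n) - psi Q f (slev Q f (n+1))) := by
  rw [← ofReal_integral_eq_lintegral_ofReal]
  · congr 1
    exact integral_sub (psi_integrable hi _) (psi_integrable hi _)
  · exact (psi_integrable hi _).sub (psi_integrable hi _)
  · exact Filter.Eventually.of_forall fun y => dd_nonneg n y

theorem prod_acc (hη : Measurable η) (hυ : Measurable υ)
    (hν : ν.map (fun w => (η w, υ w)) = Q.prod (volume.restrict (Set.Ico (0:ℝ) 1)))
    (hf : Measurable f) (hi : Integrable f Q) (h0 : ∀ y, 0 ≤ f y)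
    (h1 : ∫ y, f y ∂Q = 1) (n : ℕ) :
    ∏ m ∈ Finset.range n, ν (acc Q η υ f m)ᶜ = ENNReal.ofReal (psi Q f (slev Q f n)) := by
  induction n with
  | zero => simp [slev, psi_zero h0 h1]
  | succ k ih =>
    rw [Finset.prod_range_succ, ih, prob_compl_eq_one_sub (acc_meas hη hυ hf k),
      ENNReal.mul_sub (fun _ _ => ENNReal.ofReal_ne_top), mul_one]
    have := acc_prob hη hυ hν hf k MeasurableSet.univ
    simp only [Set.preimage_univ, Set.inter_univ, Measure.restrict_univ] at this
    rw [this, dd_integral hi, ← ENNReal.ofReal_sub]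
    · congr 1; ring
    · exact sub_nonneg.2 (psi_anti hi (slev_mono (Nat.le_succ k)))

/-- first acceptance at step `n` -/
def first (Q : Measure 𝒴) (η : 𝒲 → 𝒴) (υ : 𝒲 → ℝ) (f : 𝒴 → ℝ) (n : ℕ) : Set (ℕ → 𝒲) :=
  {z | (∀ m < n, z m ∉ acc Q η υ f m) ∧ z n ∈ acc Q η υ f n}

theorem kidx_first {n : ℕ} {z : ℕ → 𝒲} (hz : z ∈ first Q η υ f n) : kidx Q η υ f z = n := by
  refine le_antisymm (Nat.sInf_le hz.2) ?_
  by_contra hlt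
  exact hz.1 _ (not_le.1 hlt) (Nat.sInf_mem (s := {n | z n ∈ acc Q η υ f n}) ⟨n, hz.2⟩)

theorem first_prob (hη : Measurable η) (hυ : Measurable υ)
    (hν : ν.map (fun w => (η w, υ w)) = Q.prod (volume.restrict (Set.Ico (0:ℝ) 1)))
    (hf : Measurable f) (hi : Integrable f Q) (h0 : ∀ y, 0 ≤ f y)
    (h1 : ∫ y, f y ∂Q = 1) (n : ℕ) {B : Set 𝒴} (hB : MeasurableSet B) :
    Measure.infinitePi (fun _ : ℕ => ν) (first Q η υ f n ∩ {z | η (z n) ∈ B}) =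
      ∫⁻ y in B, ENNReal.ofReal (dd Q f n y) ∂Q := by
  classical
  have : first Q η υ f n ∩ {z | η (z n) ∈ B} = Set.pi (Finset.range (n+1) : Set ℕ)
      (fun m => if m = n then acc Q η υ f n ∩ η ⁻¹' B else (acc Q η υ f m)ᶜ) := by
    ext z
    simp only [first, Set.mem_inter_iff, Set.mem_ofPred_eq, Set.mem_pi, Finset.coe_range, Set.mem_Iio]
    constructor
    · rintro ⟨⟨h1, h2⟩, h3⟩ m hm
      by_cases hmn : m = n
      · rw [if_pos hmn, hmn]; exact ⟨h2, h3⟩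
      · rw [if_neg hmn]; exact h1 m (by omega)
    · intro h
      have hn := h n (by omega)
      rw [if_pos rfl] at hn
      refine ⟨⟨fun m hm => ?_, hn.1⟩, hn.2⟩
      have := h m (by omega)
      rwa [if_neg (by omega)] at this
  rw [this, Measure.infinitePi_pi, Finset.prod_range_succ, if_pos rfl, ← acc_prob hη hυ hν hf n hB,
    ← prod_acc hη hυ hν hf hi h0 h1 n]
  · congr 1
    refine Finset.prod_congr rfl fun m hm => ?_
    rw [Finset.mem_range] at hm
    rw [if_neg (by omega)]
  · intro m _
    split_ifs
    · exact (acc_meas hη hυ hf n).inter (hη hB)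
    · exact (acc_meas hη hυ hf m).compl

theorem first_meas (hη : Measurable η) (hυ : Measurable υ) (hf : Measurable f) (n : ℕ) :
    MeasurableSet (first Q η υ f n) := by
  have : first Q η υ f n = (⋂ m ∈ Finset.range n, {z : ℕ → 𝒲 | z m ∈ acc Q η υ f m}ᶜ) ∩
      {z | z n ∈ acc Q η υ f n} := by
    ext z; simp [first]
  rw [this]
  exact (Finset.measurableSet_biInter _ fun m _ =>
    (measurable_pi_apply m (acc_meas hη hυ hf m)).compl).inter
      (measurable_pi_apply n (acc_meas hη hυ hf n))

theorem first_disj : Pairwise (Function.onFun Disjoint (first Q η υ f)) := by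
  intro m n hmn
  rw [Function.onFun, Set.disjoint_left]
  intro z hm hn
  exact hmn ((kidx_first hm).symm.trans (kidx_first hn))

theorem first_cover (hη : Measurable η) (hυ : Measurable υ)
    (hν : ν.map (fun w => (η w, υ w)) = Q.prod (volume.restrict (Set.Ico (0:ℝ) 1)))
    (hf : Measurable f) (hi : Integrable f Q) (h0 : ∀ y, 0 ≤ f y)
    (h1 : ∫ y, f y ∂Q = 1) :
    ∀ᵐ z ∂(Measure.infinitePi (fun _ : ℕ => ν)), z ∈ ⋃ n, first Q η υ f n := by
  have hm : MeasurableSet (⋃ n, first Q η υ f n) := MeasurableSet.iUnion (first_meas hη hυ hf)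
  refine (mem_ae_iff_prob_eq_one hm).2 ?_
  rw [measure_iUnion first_disj (first_meas hη hυ hf)]
  have e : ∀ n, Measure.infinitePi (fun _ : ℕ => ν) (first Q η υ f n) =
      ENNReal.ofReal (psi Q f (slev Q f n) - psi Q f (slev Q f (n+1))) := by
    intro n
    have := first_prob hη hυ hν hf hi h0 h1 n MeasurableSet.univ
    simpa [dd_integral hi] using this
  simp only [e]
  have hnn : ∀ n, 0 ≤ psi Q f (slev Q f n) - psi Q f (slev Q f (n+1)) := fun n =>
    sub_nonneg.2 (psi_anti hi (slev_mono (Nat.le_succ n)))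
  have ht := (ENNReal.summable (f := fun n => ENNReal.ofReal
    (psi Q f (slev Q f n) - psi Q f (slev Q f (n+1))))).hasSum.tendsto_sum_nat
  refine tendsto_nhds_unique ht ?_
  have : (fun N => ∑ n ∈ Finset.range N, ENNReal.ofReal
      (psi Q f (slev Q f n) - psi Q f (slev Q f (n+1)))) =
      fun N => ENNReal.ofReal (1 - psi Q f (slev Q f N)) := by
    ext N
    rw [← ENNReal.ofReal_sum_of_nonneg (fun n _ => hnn n), Finset.sum_range_sub']
    simp [slev, psi_zero h0 h1]
  rw [this]
  have := ((psi_slev_tendsto hi).const_sub 1)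
  rw [sub_zero] at this
  rw [← ENNReal.ofReal_one]
  exact (ENNReal.continuous_ofReal.tendsto 1).comp this

theorem sample_law (hη : Measurable η) (hυ : Measurable υ)
    (hν : ν.map (fun w => (η w, υ w)) = Q.prod (volume.restrict (Set.Ico (0:ℝ) 1)))
    (hf : Measurable f) (hi : Integrable f Q) (h0 : ∀ y, 0 ≤ f y)
    (h1 : ∫ y, f y ∂Q = 1) {G : (ℕ → 𝒲) → 𝒴} (hG : Measurable G)
    (hGe : ∀ z, G z = η (z (kidx Q η υ f z))) :
    (Measure.infinitePi (fun _ : ℕ => ν)).map G = Q.withDensity fun y => ENNReal.ofReal (f y) := by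
  have : IsProbabilityMeasure ((Measure.infinitePi (fun _ : ℕ => ν)).map G) :=
    Measure.isProbabilityMeasure_map hG.aemeasurable
  have : IsProbabilityMeasure (Q.withDensity fun y => ENNReal.ofReal (f y)) := by
    constructor
    rw [withDensity_apply _ MeasurableSet.univ, Measure.restrict_univ,
      ← ofReal_integral_eq_lintegral_ofReal hi (Filter.Eventually.of_forall h0), h1,
      ENNReal.ofReal_one]
  refine Measure.eq_of_le_of_isProbabilityMeasure ?_
  refine Measure.le_iff.2 fun B hB => ?_
  rw [Measure.map_apply hG hB, withDensity_apply _ hB]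
  calc _ ≤ Measure.infinitePi (fun _ : ℕ => ν) (⋃ n, first Q η υ f n ∩ {z | η (z n) ∈ B}) := by
        refine measure_mono_ae ?_
        filter_upwards [first_cover hη hυ hν hf hi h0 h1] with z hz hzB
        obtain ⟨n, hn⟩ := Set.mem_iUnion.1 hz
        refine Set.mem_iUnion.2 ⟨n, hn, ?_⟩
        have : G z ∈ B := hzB
        rw [hGe, kidx_first hn] at this
        exact this
    _ ≤ ∑' n, Measure.infinitePi (fun _ : ℕ => ν) (first Q η υ f n ∩ {z | η (z n) ∈ B}) :=
        measure_iUnion_le _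
    _ = ∑' n, ∫⁻ y in B, ENNReal.ofReal (dd Q f n y) ∂Q := by
        congr 1; ext n; exact first_prob hη hυ hν hf hi h0 h1 n hB
    _ = ∫⁻ y in B, ∑' n, ENNReal.ofReal (dd Q f n y) ∂Q := by
        rw [lintegral_tsum]
        intro n
        unfold dd
        fun_prop
    _ ≤ _ := by
        refine lintegral_mono fun y => ?_
        rw [ENNReal.tsum_eq_iSup_nat]
        refine iSup_le fun N => ?_
        rw [← ENNReal.ofReal_sum_of_nonneg (fun n _ => dd_nonneg n y)]
        apply ENNReal.ofReal_le_ofReal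
        unfold dd
        rw [Finset.sum_range_sub' (fun n => max (f y - slev Q f n) 0)]
        have := le_max_right (f y - slev Q f N) 0
        simp only [slev, sub_zero, max_eq_left (h0 y)]
        linarith

theorem sample_log (hη : Measurable η) (hυ : Measurable υ)
    (hν : ν.map (fun w => (η w, υ w)) = Q.prod (volume.restrict (Set.Ico (0:ℝ) 1)))
    (hf : Measurable f) (hi : Integrable f Q) (h0 : ∀ y, 0 ≤ f y)
    (h1 : ∫ y, f y ∂Q = 1) (hfl : Integrable (fun y => f y * Real.log (f y)) Q) :
    0 ≤ (∫ y, f y * Real.log (f y) ∂Q) + 1 ∧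
    ∫⁻ z, ENNReal.ofReal (Real.log ((kidx Q η υ f z : ℝ) + 1)) ∂(Measure.infinitePi (fun _ : ℕ => ν))
      ≤ ENNReal.ofReal ((∫ y, f y * Real.log (f y) ∂Q) + 1) := by
  obtain ⟨b1, b2⟩ := log_bound hf hi h0 h1 hfl
  refine ⟨b1, le_trans (le_of_eq ?_) b2⟩
  rw [← Measure.restrict_eq_self_of_ae_mem (first_cover hη hυ hν hf hi h0 h1),
    lintegral_iUnion (first_meas hη hυ hf) first_disj]
  congr 1; ext n
  have := first_prob hη hυ hν hf hi h0 h1 n MeasurableSet.univ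
  simp only [Set.mem_univ, Set.ofPred_true, Set.inter_univ, Measure.restrict_univ,
    dd_integral hi] at this
  rw [← this, ← setLIntegral_const]
  refine setLIntegral_congr_fun (first_meas hη hυ hf n) fun z hz => ?_
  simp only [kidx_first hz]
end Samp

theorem klBits_le {α : Type*} [MeasurableSpace α] {P M : Measure α} [IsProbabilityMeasure P]
    [IsProbabilityMeasure M] {h : α → ℝ≥0∞} (hm : Measurable h) {q : α → ℝ} (hqm : Measurable q)
    (hq0 : ∀ a, 0 < q a)
    (hac : ∀ A, MeasurableSet A → P A ≤ ∫⁻ a in A, h a ∂M)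
    (hq : ∫⁻ a, ENNReal.ofReal (q a) * h a ∂P ≤ 1)
    {B : ℝ} (hB0 : ∀ a, 0 ≤ - Real.logb 2 (q a))
    (hB : ∫⁻ a, ENNReal.ofReal (- Real.logb 2 (q a)) ∂P ≤ ENNReal.ofReal B) :
    klBits P M ≤ ENNReal.ofReal B := by
  have hPM : P ≪ M := by
    refine Measure.AbsolutelyContinuous.mk fun A hA hRA => ?_
    refine le_antisymm ((hac A hA).trans ?_) zero_le
    rw [Measure.restrict_eq_zero.2 hRA]; simp
  set r := P.rnDeriv M with hr
  have hrm : Measurable r := Measure.measurable_rnDeriv P M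
  have hrh : r ≤ᵐ[M] h := by
    refine ae_le_of_forall_setLIntegral_le_of_sigmaFinite hrm fun A hA _ => ?_
    rw [Measure.setLIntegral_rnDeriv hPM]
    exact hac A hA
  have hrhP : r ≤ᵐ[P] h := hPM.ae_le hrh
  have hpos : ∀ᵐ a ∂P, 0 < r a := Measure.rnDeriv_pos hPM
  have hfin : ∀ᵐ a ∂P, r a < ⊤ := hPM.ae_le (Measure.rnDeriv_lt_top P M)
  -- φ = q * r
  set φ : α → ℝ := fun a => q a * (r a).toReal with hφ
  have hφm : Measurable φ := hqm.mul hrm.ennreal_toReal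
  have hφ0 : ∀ a, 0 ≤ φ a := fun a => mul_nonneg (hq0 a).le ENNReal.toReal_nonneg
  have hφl : ∫⁻ a, ENNReal.ofReal (φ a) ∂P ≤ 1 := by
    refine le_trans (lintegral_mono_ae ?_) hq
    filter_upwards [hrhP, hfin] with a ha ha'
    rw [hφ]
    simp only
    rw [ENNReal.ofReal_mul (hq0 a).le, ENNReal.ofReal_toReal ha'.ne]
    gcongr
  have hφi : Integrable φ P := by
    refine ⟨hφm.aestronglyMeasurable, ?_⟩
    rw [hasFiniteIntegral_iff_ofReal (Filter.Eventually.of_forall hφ0)]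
    exact hφl.trans_lt ENNReal.one_lt_top
  have hφ1 : ∫ a, φ a ∂P ≤ 1 := by
    rw [integral_eq_lintegral_of_nonneg_ae (Filter.Eventually.of_forall hφ0)
      hφm.aestronglyMeasurable]
    exact ENNReal.toReal_le_of_le_ofReal zero_le_one (by simpa using hφl)
  -- code length
  have hlm : Measurable fun a => - Real.logb 2 (q a) := by
    unfold Real.logb; exact (hqm.log.div_const _).neg
  have hli : Integrable (fun a => - Real.logb 2 (q a)) P := by
    refine ⟨hlm.aestronglyMeasurable, ?_⟩
    rw [hasFiniteIntegral_iff_ofReal (Filter.Eventually.of_forall hB0)]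
    exact hB.trans_lt ENNReal.ofReal_lt_top
  -- 1/r
  have hinv : ∫⁻ a, (r a)⁻¹ ∂P ≤ 1 := by
    have : ∫⁻ a, (r a)⁻¹ ∂P = ∫⁻ a, r a * (r a)⁻¹ ∂M := by
      exact (lintegral_rnDeriv_mul hPM (f := fun a => (r a)⁻¹) hrm.inv.aemeasurable).symm
    rw [this]
    calc _ ≤ ∫⁻ a, 1 ∂M := lintegral_mono fun a => ENNReal.mul_inv_le_one _
      _ = 1 := by simp
  have hinvi : Integrable (fun a => ((r a)⁻¹).toReal) P :=
    integrable_toReal_of_lintegral_ne_top hrm.inv.aemeasurable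
      (hinv.trans_lt ENNReal.one_lt_top).ne
  have hl2 : 0 < Real.log 2 := Real.log_pos (by norm_num)
  have hup : ∀ᵐ a ∂P, Real.logb 2 (r a).toReal ≤
      (φ a - 1) / Real.log 2 + (- Real.logb 2 (q a)) := by
    filter_upwards [hpos, hfin] with a h1 h2
    have hr0 : 0 < (r a).toReal := ENNReal.toReal_pos h1.ne' h2.ne
    have := Real.log_le_sub_one_of_pos (mul_pos (hq0 a) hr0)
    rw [Real.log_mul (hq0 a).ne' hr0.ne'] at this
    unfold Real.logb
    rw [← neg_div, ← add_div]
    gcongr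
    simp only [hφ]; linarith
  have hlo : ∀ᵐ a ∂P, - (((r a)⁻¹).toReal / Real.log 2) ≤ Real.logb 2 (r a).toReal := by
    filter_upwards [hpos, hfin] with a h1 h2
    have hr0 : 0 < (r a).toReal := ENNReal.toReal_pos h1.ne' h2.ne
    have := Real.one_sub_inv_le_log_of_pos hr0
    unfold Real.logb
    rw [← neg_div, ENNReal.toReal_inv]
    gcongr
    linarith
  have hupi : Integrable (fun a => (φ a - 1) / Real.log 2 + (- Real.logb 2 (q a))) P :=
    ((hφi.sub (integrable_const 1)).div_const _).add hli
  have hlogint : Integrable (fun a => Real.logb 2 (r a).toReal) P := by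
    refine Integrable.mono' (hupi.abs.add (hinvi.div_const (Real.log 2)).abs) ?_ ?_
    · unfold Real.logb
      exact (hrm.ennreal_toReal.log.div_const _).aestronglyMeasurable
    · filter_upwards [hup, hlo] with a h1 h2
      rw [Real.norm_eq_abs, abs_le]
      simp only [Pi.add_apply]
      have c1 := le_abs_self ((φ a - 1) / Real.log 2 + (- Real.logb 2 (q a)))
      have c2 := abs_nonneg ((φ a - 1) / Real.log 2 + (- Real.logb 2 (q a)))
      have c3 := le_abs_self (((r a)⁻¹).toReal / Real.log 2)
      have c4 := abs_nonneg (((r a)⁻¹).toReal / Real.log 2)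
      constructor <;> linarith
  unfold klBits
  rw [if_pos ⟨hPM, hlogint⟩]
  have h3 : ∫ a, Real.logb 2 (r a).toReal ∂P ≤ ∫ a, - Real.logb 2 (q a) ∂P := by
    refine (integral_mono_ae hlogint hupi hup).trans ?_
    have hdi : Integrable (fun a => (φ a - 1) / Real.log 2) P :=
      (hφi.sub (integrable_const 1)).div_const _
    rw [integral_add hdi hli, integral_div, integral_sub hφi (integrable_const 1)]
    have : (∫ a, φ a ∂P - ∫ _a, (1:ℝ) ∂P) / Real.log 2 ≤ 0 := by
      apply div_nonpos_of_nonpos_of_nonneg _ hl2.le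
      simpa using hφ1
    linarith
  refine (ENNReal.ofReal_le_ofReal h3).trans ?_
  rw [ofReal_integral_eq_lintegral_ofReal hli (Filter.Eventually.of_forall hB0)]
  exact hB

theorem kl_code {𝒳 𝒵 𝒴 : Type*} [MeasurableSpace 𝒳] [MeasurableSpace 𝒵] [MeasurableSpace 𝒴]
    {α : Measure 𝒳} [IsProbabilityMeasure α] {ζ : Measure 𝒵} [IsProbabilityMeasure ζ]
    {K : 𝒳 × 𝒵 → ℕ} (hK : Measurable K) {t : ℕ → 𝒵 → 𝒴} {g : 𝒳 × 𝒵 → 𝒴}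
    (hg : Measurable g) (hgt : ∀ x z, g (x, z) = t (K (x, z)) z)
    {q : ℕ → ℝ} (hq0 : ∀ n, 0 < q n) (hq1 : ∑' n, ENNReal.ofReal (q n) ≤ 1) {B : ℝ}
    (hB : ∫⁻ p, ENNReal.ofReal (- Real.logb 2 (q (K p))) ∂(α.prod ζ) ≤ ENNReal.ofReal B) :
    klBits ((α.prod ζ).map fun p => (p.1, (p.2, g p)))
      (α.prod ((α.prod ζ).map fun p => (p.2, g p))) ≤ ENNReal.ofReal B := by
  have hm1 : Measurable fun p : 𝒳 × 𝒵 => (p.1, (p.2, g p)) :=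
    measurable_fst.prodMk (measurable_snd.prodMk hg)
  have hm2 : Measurable fun p : 𝒳 × 𝒵 => (p.2, g p) := measurable_snd.prodMk hg
  have : IsProbabilityMeasure ((α.prod ζ).map fun p => (p.1, (p.2, g p))) :=
    Measure.isProbabilityMeasure_map hm1.aemeasurable
  have : IsProbabilityMeasure ((α.prod ζ).map fun p => (p.2, g p)) :=
    Measure.isProbabilityMeasure_map hm2.aemeasurable
  -- p_k(z)
  set pk : ℕ → 𝒵 → ℝ≥0∞ := fun k z => α {x | K (x, z) = k} with hpk
  have hKk : ∀ k, MeasurableSet {p : 𝒳 × 𝒵 | K p = k} := fun k => hK (measurableSet_singleton k)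
  have hpkm : ∀ k, Measurable (pk k) := fun k => measurable_measure_prodMk_right (hKk k)
  have hpk' : Measurable fun p : ℕ × 𝒵 => pk p.1 p.2 := measurable_from_prod_countable_right hpkm
  set H : 𝒳 × 𝒵 → ℝ≥0∞ := fun p => (pk (K p) p.2)⁻¹ with hH
  have hHm : Measurable H := (hpk'.comp (hK.prodMk measurable_snd)).inv
  have hproj : Measurable fun p : 𝒳 × 𝒵 × 𝒴 => (p.1, p.2.1) :=
    measurable_fst.prodMk (measurable_fst.comp measurable_snd)
  have hnull : ∀ᵐ p ∂(α.prod ζ), pk (K p) p.2 ≠ 0 := by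
    have : ∀ k, ∀ᵐ p ∂(α.prod ζ), K p = k → pk k p.2 ≠ 0 := by
      intro k
      have hms : MeasurableSet {p : 𝒳 × 𝒵 | K p = k ∧ pk k p.2 = 0} :=
        (hKk k).inter (((hpkm k).comp measurable_snd) (measurableSet_singleton 0))
      rw [ae_iff]
      have e : {p : 𝒳 × 𝒵 | ¬(K p = k → pk k p.2 ≠ 0)} = {p : 𝒳 × 𝒵 | K p = k ∧ pk k p.2 = 0} := by
        ext p; simp
      rw [e, Measure.prod_apply_symm hms]
      rw [lintegral_eq_zero_iff (measurable_measure_prodMk_right hms)]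
      refine Filter.Eventually.of_forall fun z => ?_
      simp only [Pi.zero_apply]
      by_cases hz : pk k z = 0
      · refine measure_mono_null (fun x hx => ?_) hz
        exact hx.1
      · convert measure_empty (μ := α)
        ext x; simp [hz]
    have := ae_all_iff.2 this
    filter_upwards [this] with p hp using hp (K p) rfl
  refine klBits_le (h := fun p => H (p.1, p.2.1)) (q := fun p => q (K (p.1, p.2.1)))
    (hHm.comp hproj) ((measurable_from_nat.comp hK).comp hproj)
    (fun _ => hq0 _) ?_ ?_ ?_ ?_
  · -- density domination
    intro A hA
    have hi : Measurable (A.indicator fun p : 𝒳 × 𝒵 × 𝒴 => H (p.1, p.2.1)) :=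
      (hHm.comp hproj).indicator hA
    rw [Measure.map_apply hm1 hA, ← lintegral_indicator hA, lintegral_prod _ hi.aemeasurable]
    have e1 : ∀ x, ∫⁻ y, A.indicator (fun p : 𝒳 × 𝒵 × 𝒴 => H (p.1, p.2.1)) (x, y)
        ∂((α.prod ζ).map fun p => (p.2, g p)) =
        ∫⁻ z, ∫⁻ x', A.indicator (fun p : 𝒳 × 𝒵 × 𝒴 => H (p.1, p.2.1)) (x, (z, g (x', z))) ∂α ∂ζ := by
      intro x
      rw [lintegral_map (show Measurable fun y => A.indicator (fun p : 𝒳 × 𝒵 × 𝒴 => H (p.1, p.2.1))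
        (x, y) from hi.comp measurable_prodMk_left) hm2]
      exact lintegral_prod_symm _ ((hi.comp measurable_prodMk_left).comp hm2).aemeasurable
    simp only [e1]
    rw [← lintegral_indicator_one (hm1 hA), lintegral_prod _
      (measurable_one.indicator (hm1 hA)).aemeasurable]
    have hn2 := Measure.ae_ae_of_ae_prod hnull
    refine lintegral_mono_ae ?_
    filter_upwards [hn2] with x hx
    refine lintegral_mono_ae ?_
    filter_upwards [hx] with z hz
    by_cases hxz : (x, z) ∈ (fun p : 𝒳 × 𝒵 => (p.1, (p.2, g p))) ⁻¹' A
    · rw [Set.indicator_of_mem hxz]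
      have hxz' : (x, (z, g (x, z))) ∈ A := hxz
      calc (1:ℝ≥0∞) = (pk (K (x,z)) z)⁻¹ * pk (K (x,z)) z :=
            (ENNReal.inv_mul_cancel hz (measure_ne_top _ _)).symm
        _ = ∫⁻ x' in {x' | K (x', z) = K (x, z)}, H (x, z) ∂α := by
            rw [setLIntegral_const]
        _ = ∫⁻ x' in {x' | K (x', z) = K (x, z)},
            A.indicator (fun p : 𝒳 × 𝒵 × 𝒴 => H (p.1, p.2.1)) (x, (z, g (x', z))) ∂α := by
            refine setLIntegral_congr_fun (measurable_prodMk_right (hKk _)) fun x' hx' => ?_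
            have hx' : K (x', z) = K (x, z) := hx'
            have : g (x', z) = g (x, z) := by rw [hgt, hgt, hx']
            simp only [this]
            rw [Set.indicator_of_mem hxz']
        _ ≤ _ := setLIntegral_le_lintegral _ _
    · rw [Set.indicator_of_notMem hxz]; exact zero_le
  · have hqK : Measurable fun a : 𝒳 × 𝒵 × 𝒴 => q (K (a.1, a.2.1)) :=
      (measurable_from_nat.comp hK).comp hproj
    rw [lintegral_map (show Measurable fun a : 𝒳 × 𝒵 × 𝒴 =>
      ENNReal.ofReal (q (K (a.1, a.2.1))) * H (a.1, a.2.1) from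
        hqK.ennreal_ofReal.mul (hHm.comp hproj)) hm1]
    simp only [hH]
    have hmm : Measurable fun p : 𝒳 × 𝒵 => ENNReal.ofReal (q (K p)) * (pk (K p) p.2)⁻¹ :=
      (measurable_from_nat.comp hK).ennreal_ofReal.mul hHm
    rw [lintegral_prod_symm _ hmm.aemeasurable]
    calc _ ≤ ∫⁻ z, 1 ∂ζ := by
          refine lintegral_mono fun z => ?_
          have hKz : ∀ k, MeasurableSet {x | K (x, z) = k} := fun k =>
            measurable_prodMk_right (hKk k)
          have hU : ⋃ k, {x | K (x, z) = k} = Set.univ := by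
            ext x; simp
          have hdj : Pairwise (Function.onFun Disjoint fun k => {x | K (x, z) = k}) := by
            intro m n hmn
            rw [Function.onFun, Set.disjoint_left]
            intro x (h1 : K (x, z) = m) (h2 : K (x, z) = n)
            exact hmn (h1.symm.trans h2)
          rw [← setLIntegral_univ, ← hU, lintegral_iUnion hKz hdj]
          refine le_trans (ENNReal.tsum_le_tsum fun k => ?_) hq1
          calc _ = ∫⁻ x in {x | K (x, z) = k}, ENNReal.ofReal (q k) * (pk k z)⁻¹ ∂α := by
                refine setLIntegral_congr_fun (hKz k) fun x hx => ?_
                have hx : K (x, z) = k := hx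
                simp only [hx]
            _ = ENNReal.ofReal (q k) * ((pk k z)⁻¹ * pk k z) := by
                rw [setLIntegral_const, mul_assoc]
            _ ≤ ENNReal.ofReal (q k) * 1 := by
                gcongr
                exact ENNReal.inv_mul_le_one _
            _ = _ := mul_one _
      _ = 1 := by simp
  · intro p
    rw [neg_nonneg]
    refine Real.logb_nonpos (by norm_num) (hq0 _).le ?_
    have := (ENNReal.le_tsum (f := fun n => ENNReal.ofReal (q n)) (K (p.1, p.2.1))).trans hq1
    rw [← ENNReal.ofReal_one] at this
    exact (ENNReal.ofReal_le_ofReal_iff zero_le_one).1 this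
  · rw [lintegral_map (Measurable.ennreal_ofReal ?_) hm1]
    · exact hB
    · unfold Real.logb
      exact (((measurable_from_nat.comp hK).comp hproj).log.div_const _).neg

section Joint
variable {𝒳 𝒴 𝒲 : Type*} [MeasurableSpace 𝒳] [MeasurableSpace 𝒴] [MeasurableSpace 𝒲]
  {Q : Measure 𝒴} [IsProbabilityMeasure Q] {f : 𝒳 × 𝒴 → ℝ} {η : 𝒲 → 𝒴} {υ : 𝒲 → ℝ}

theorem psi_joint (hf : Measurable f) {s : 𝒳 → ℝ} (hs : Measurable s) :
    Measurable fun x => psi Q (fun y => f (x, y)) (s x) := by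
  have : Measurable fun p : 𝒳 × 𝒴 => max (f p - s p.1) 0 :=
    (hf.sub (hs.comp measurable_fst)).max measurable_const
  exact (this.stronglyMeasurable.integral_prod_right' (ν := Q)).measurable

theorem slev_joint (hf : Measurable f) (n : ℕ) :
    Measurable fun x => slev Q (fun y => f (x, y)) n := by
  induction n with
  | zero => exact measurable_const
  | succ n ih => exact ih.add (psi_joint hf ih)

theorem kidx_joint (hη : Measurable η) (hυ : Measurable υ) (hf : Measurable f) :
    Measurable fun p : 𝒳 × (ℕ → 𝒲) => kidx Q η υ (fun y => f (p.1, y)) p.2 := by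
  refine measurable_sInf_nat (S := fun n => {p : 𝒳 × (ℕ → 𝒲) |
    p.2 n ∈ acc Q η υ (fun y => f (p.1, y)) n}) fun n => ?_
  have hz : Measurable fun p : 𝒳 × (ℕ → 𝒲) => p.2 n := (measurable_pi_apply n).comp measurable_snd
  have hs := slev_joint (Q := Q) hf n
  refine measurableSet_lt (α := ℝ) ((hs.comp measurable_fst).add ((hυ.comp hz).mul
    ((psi_joint hf hs).comp measurable_fst))) ?_
  exact hf.comp (measurable_fst.prodMk (hη.comp hz))

theorem samp_joint (hη : Measurable η) (hυ : Measurable υ) (hf : Measurable f) :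
    Measurable fun p : 𝒳 × (ℕ → 𝒲) => η (p.2 (kidx Q η υ (fun y => f (p.1, y)) p.2)) := by
  have h1 : Measurable fun p : ℕ × (ℕ → 𝒲) => η (p.2 p.1) :=
    measurable_from_prod_countable_right fun n => hη.comp (measurable_pi_apply n)
  exact h1.comp ((kidx_joint (Q := Q) hη hυ hf).prodMk measurable_snd)

end Joint

theorem exists_density {𝒳 𝒴 : Type*} [MeasurableSpace 𝒳] [MeasurableSpace 𝒴]
    {α : Measure 𝒳} [IsProbabilityMeasure α] {Q : Measure 𝒴} [IsProbabilityMeasure Q]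
    {P : Measure (𝒳 × 𝒴)} [IsProbabilityMeasure P] (hfst : P.map Prod.fst = α)
    (hac : P ≪ α.prod Q)
    (hlogint : Integrable (fun x => Real.logb 2 (P.rnDeriv (α.prod Q) x).toReal) P) :
    ∃ f : 𝒳 × 𝒴 → ℝ, Measurable f ∧ (∀ p, 0 ≤ f p) ∧
      (∀ x, Integrable (fun y => f (x, y)) Q) ∧ (∀ x, ∫ y, f (x, y) ∂Q = 1) ∧
      P = (α.prod Q).withDensity (fun p => ENNReal.ofReal (f p)) ∧
      (∀ᵐ x ∂α, Integrable (fun y => f (x, y) * Real.log (f (x, y))) Q) ∧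
      Integrable (fun x => ∫ y, f (x, y) * Real.log (f (x, y)) ∂Q) α ∧
      ∫ x, ∫ y, f (x, y) * Real.log (f (x, y)) ∂Q ∂α =
        Real.log 2 * ∫ x, Real.logb 2 (P.rnDeriv (α.prod Q) x).toReal ∂P := by
  classical
  set r := P.rnDeriv (α.prod Q) with hr
  have hrm : Measurable r := Measure.measurable_rnDeriv _ _
  set L : 𝒳 → ℝ≥0∞ := fun x => ∫⁻ y, r (x, y) ∂Q with hL
  have hLm : Measurable L := hrm.lintegral_prod_right'
  have hL1 : L =ᵐ[α] fun _ => 1 := by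
    refine ae_eq_of_forall_setLIntegral_eq_of_sigmaFinite hLm measurable_const fun A hA _ => ?_
    have e : ∫⁻ p in A ×ˢ Set.univ, r p ∂(α.prod Q) = P (A ×ˢ Set.univ) :=
      Measure.setLIntegral_rnDeriv hac _
    rw [setLIntegral_prod _ hrm.aemeasurable, Measure.restrict_univ] at e
    rw [e, setLIntegral_one, ← hfst, Measure.map_apply measurable_fst hA]
    congr 1
    ext p; simp
  have hLs : MeasurableSet {p : 𝒳 × 𝒴 | L p.1 = 1} :=
    (hLm.comp measurable_fst) (measurableSet_singleton 1)
  set f : 𝒳 × 𝒴 → ℝ := fun p => if L p.1 = 1 then (r p).toReal else 1 with hf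
  have hfm : Measurable f := Measurable.ite hLs hrm.ennreal_toReal measurable_const
  have hf0 : ∀ p, 0 ≤ f p := by
    intro p; simp only [hf]; split_ifs
    · exact ENNReal.toReal_nonneg
    · exact zero_le_one
  have hrx : ∀ x, Measurable fun y => r (x, y) := fun x => hrm.comp measurable_prodMk_left
  have hfx : ∀ x, Measurable fun y => f (x, y) := fun x => hfm.comp measurable_prodMk_left
  have hfl : ∀ x, ∫⁻ y, ENNReal.ofReal (f (x, y)) ∂Q = 1 := by
    intro x
    by_cases hx : L x = 1
    · have hx' : ∫⁻ y, r (x, y) ∂Q = 1 := hx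
      have : ∀ᵐ y ∂Q, r (x, y) < ⊤ := ae_lt_top (hrx x) (by rw [hx']; simp)
      rw [← hx']
      refine lintegral_congr_ae ?_
      filter_upwards [this] with y hy
      simp only [hf, hx, if_true]
      exact ENNReal.ofReal_toReal hy.ne
    · simp [hf, hx]
  have hfi : ∀ x, Integrable (fun y => f (x, y)) Q := by
    intro x
    refine ⟨(hfx x).aestronglyMeasurable, ?_⟩
    rw [hasFiniteIntegral_iff_ofReal (Filter.Eventually.of_forall fun y => hf0 _), hfl]
    exact ENNReal.one_lt_top
  have hfr : f =ᵐ[α.prod Q] fun p => (r p).toReal := by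
    have : ∀ᵐ p ∂(α.prod Q), L p.1 = 1 :=
      (Measure.quasiMeasurePreserving_fst (μ := α) (ν := Q)).ae hL1
    filter_upwards [this] with p hp
    simp [hf, hp]
  have hflog : (fun p => f p * Real.log (f p)) =ᵐ[α.prod Q]
      fun p => Real.log 2 * ((r p).toReal • Real.logb 2 (r p).toReal) := by
    filter_upwards [hfr] with p hp
    rw [hp, smul_eq_mul, Real.logb]
    have : Real.log 2 ≠ 0 := (Real.log_pos (by norm_num)).ne'
    field_simp
  have hI : Integrable (fun p => f p * Real.log (f p)) (α.prod Q) := by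
    rw [integrable_congr hflog]
    exact ((integrable_rnDeriv_smul_iff hac).2 hlogint).const_mul _
  refine ⟨f, hfm, hf0, hfi, ?_, ?_, hI.prod_right_ae, hI.integral_prod_left, ?_⟩
  · intro x
    rw [integral_eq_lintegral_of_nonneg_ae (Filter.Eventually.of_forall fun y => hf0 _)
      (hfx x).aestronglyMeasurable, hfl, ENNReal.toReal_one]
  · rw [← Measure.withDensity_rnDeriv_eq _ _ hac]
    refine withDensity_congr_ae ?_
    filter_upwards [hfr, Measure.rnDeriv_lt_top P (α.prod Q)] with p hp hp'
    rw [hp, ENNReal.ofReal_toReal hp'.ne]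
  · rw [← integral_prod _ hI, integral_congr_ae hflog, integral_const_mul,
      integral_rnDeriv_smul hac]

theorem sfrl_core {𝒳 𝒴 𝒲 : Type*} [MeasurableSpace 𝒳] [MeasurableSpace 𝒴] [MeasurableSpace 𝒲]
    {α : Measure 𝒳} [IsProbabilityMeasure α] {Q : Measure 𝒴} [IsProbabilityMeasure Q]
    {ν : Measure 𝒲} [IsProbabilityMeasure ν] {η : 𝒲 → 𝒴} {υ : 𝒲 → ℝ}
    (hη : Measurable η) (hυ : Measurable υ)
    (hν : ν.map (fun w => (η w, υ w)) = Q.prod (volume.restrict (Set.Ico (0:ℝ) 1)))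
    {P : Measure (𝒳 × 𝒴)} [IsProbabilityMeasure P] (hfst : P.map Prod.fst = α)
    (hac : P ≪ α.prod Q)
    (hlogint : Integrable (fun x => Real.logb 2 (P.rnDeriv (α.prod Q) x).toReal) P)
    {I : ℝ} (hI0 : 0 ≤ I) (hI : ∫ x, Real.logb 2 (P.rnDeriv (α.prod Q) x).toReal ∂P ≤ I) :
    ∃ g : 𝒳 × (ℕ → 𝒲) → 𝒴, Measurable g ∧
      (α.prod (Measure.infinitePi fun _ : ℕ => ν)).map (fun p => (p.1, g p)) = P ∧
      klBits ((α.prod (Measure.infinitePi fun _ : ℕ => ν)).map fun p => (p.1, (p.2, g p)))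
        (α.prod ((α.prod (Measure.infinitePi fun _ : ℕ => ν)).map fun p => (p.2, g p))) ≤
        ENNReal.ofReal (I + (Real.logb 2 (I + 1) + 4)) := by
  obtain ⟨f, hf, hf0, hfi, hf1, hPf, hfl, hDi, hD⟩ := exists_density hfst hac hlogint
  set ζ : Measure (ℕ → 𝒲) := Measure.infinitePi fun _ : ℕ => ν with hζ
  have hfx : ∀ x, Measurable fun y => f (x, y) := fun x => hf.comp measurable_prodMk_left
  set K : 𝒳 × (ℕ → 𝒲) → ℕ := fun p => kidx Q η υ (fun y => f (p.1, y)) p.2 with hK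
  have hKm : Measurable K := kidx_joint hη hυ hf
  set g : 𝒳 × (ℕ → 𝒲) → 𝒴 := fun p => η (p.2 (K p)) with hg
  have hgm : Measurable g := samp_joint hη hυ hf
  have hl2 : 0 < Real.log 2 := Real.log_pos (by norm_num)
  refine ⟨g, hgm, ?_, ?_⟩
  · have hm : Measurable fun p : 𝒳 × (ℕ → 𝒲) => (p.1, g p) := measurable_fst.prodMk hgm
    refine Measure.ext fun A hA => ?_
    rw [Measure.map_apply hm hA, Measure.prod_apply (hm hA)]
    conv_rhs => rw [hPf]
    rw [withDensity_apply _ hA, ← lintegral_indicator hA,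
      lintegral_prod _ (hf.ennreal_ofReal.indicator hA).aemeasurable]
    refine lintegral_congr fun x => ?_
    have hAx : MeasurableSet (Prod.mk x ⁻¹' A) := measurable_prodMk_left hA
    have hgx : Measurable fun z => g (x, z) := hgm.comp measurable_prodMk_left
    have := sample_law (ν := ν) hη hυ hν (hfx x) (hfi x) (fun y => hf0 _) (hf1 x) hgx
      (fun z => rfl)
    have e : ζ (Prod.mk x ⁻¹' ((fun p : 𝒳 × (ℕ → 𝒲) => (p.1, g p)) ⁻¹' A)) =
        (ζ.map fun z => g (x, z)) (Prod.mk x ⁻¹' A) := by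
      rw [Measure.map_apply hgx hAx]; rfl
    rw [e, this, withDensity_apply _ hAx, ← lintegral_indicator hAx]
    rfl
  · set B : ℝ := I + 1 / Real.log 2 with hB
    have hB0 : 0 < B := by positivity
    have hlogB : 0 ≤ Real.logb 2 (1 + B) := Real.logb_nonneg (by norm_num) (by linarith)
    have hc0 : 0 ≤ (1 + B⁻¹) / Real.log 2 := by positivity
    refine (kl_code hKm (t := fun n z => η (z n)) hgm (fun x z => rfl) (qw_pos hB0) (qw_sum hB0)
      (B := (1 + B⁻¹) / Real.log 2 * (I * Real.log 2 + 1) + Real.logb 2 (1 + B)) ?_).trans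
      (ENNReal.ofReal_le_ofReal (numeric I hI0))
    have hlogK : ∫⁻ p, ENNReal.ofReal (Real.log ((K p : ℝ) + 1)) ∂(α.prod ζ) ≤
        ENNReal.ofReal (I * Real.log 2 + 1) := by
      have hm : Measurable fun p => ENNReal.ofReal (Real.log ((K p : ℝ) + 1)) :=
        (((measurable_from_nat (f := fun n : ℕ => (n : ℝ))).comp hKm).add_const
          1).log.ennreal_ofReal
      rw [lintegral_prod _ hm.aemeasurable]
      have hs : ∀ᵐ x ∂α, 0 ≤ (∫ y, f (x, y) * Real.log (f (x, y)) ∂Q) + 1 ∧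
          ∫⁻ z, ENNReal.ofReal (Real.log ((K (x, z) : ℝ) + 1)) ∂ζ ≤
          ENNReal.ofReal ((∫ y, f (x, y) * Real.log (f (x, y)) ∂Q) + 1) := by
        filter_upwards [hfl] with x hx
        exact sample_log hη hυ hν (hfx x) (hfi x) (fun y => hf0 _) (hf1 x) hx
      have hDi' : Integrable (fun x => (∫ y, f (x, y) * Real.log (f (x, y)) ∂Q) + 1) α :=
        hDi.add (integrable_const 1)
      refine (lintegral_mono_ae (hs.mono fun x hx => hx.2)).trans ?_
      rw [← ofReal_integral_eq_lintegral_ofReal hDi' (hs.mono fun x hx => hx.1)]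
      refine ENNReal.ofReal_le_ofReal ?_
      rw [integral_add hDi (integrable_const 1), hD]
      simp only [integral_const, probReal_univ, smul_eq_mul, mul_one]
      nlinarith
    have hm : Measurable fun p => ENNReal.ofReal ((1 + B⁻¹) / Real.log 2) *
        ENNReal.ofReal (Real.log ((K p : ℝ) + 1)) :=
      (((measurable_from_nat (f := fun n : ℕ => (n : ℝ))).comp hKm).add_const
          1).log.ennreal_ofReal.const_mul _
    calc _ = ∫⁻ p, (ENNReal.ofReal ((1 + B⁻¹) / Real.log 2) *
          ENNReal.ofReal (Real.log ((K p : ℝ) + 1)) + ENNReal.ofReal (Real.logb 2 (1 + B)))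
          ∂(α.prod ζ) := by
          refine lintegral_congr fun p => ?_
          have h0 : 0 ≤ Real.log ((K p : ℝ) + 1) :=
            Real.log_nonneg (by linarith [Nat.cast_nonneg (α := ℝ) (K p)])
          rw [qw_log hB0, ENNReal.ofReal_add (mul_nonneg hc0 h0) hlogB, ENNReal.ofReal_mul hc0]
      _ = ENNReal.ofReal ((1 + B⁻¹) / Real.log 2) *
          (∫⁻ p, ENNReal.ofReal (Real.log ((K p : ℝ) + 1)) ∂(α.prod ζ)) +
          ENNReal.ofReal (Real.logb 2 (1 + B)) := by
          rw [lintegral_add_left hm, lintegral_const_mul' _ _ ENNReal.ofReal_ne_top]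
          simp
      _ ≤ ENNReal.ofReal ((1 + B⁻¹) / Real.log 2) * ENNReal.ofReal (I * Real.log 2 + 1) +
          ENNReal.ofReal (Real.logb 2 (1 + B)) := by gcongr
      _ = _ := by
          rw [← ENNReal.ofReal_mul hc0, ← ENNReal.ofReal_add (by positivity) hlogB]

/-- Transport of a probability measure on a standard Borel space to the reals. -/
theorem exists_real_model {𝒳 : Type*} [MeasurableSpace 𝒳] [StandardBorelSpace 𝒳]
    (α : Measure 𝒳) [IsProbabilityMeasure α] :
    ∃ (a : Measure ℝ) (φ : ℝ → 𝒳), IsProbabilityMeasure a ∧ Measurable φ ∧ a.map φ = α := by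
  have : Nonempty 𝒳 := by
    by_contra h
    rw [not_nonempty_iff] at h
    have h1 : α Set.univ = 1 := measure_univ
    rw [Set.eq_empty_of_isEmpty (Set.univ : Set 𝒳), measure_empty] at h1
    exact zero_ne_one h1
  have hemb := measurableEmbedding_embeddingReal 𝒳
  obtain ⟨φ, hφ, hφe⟩ := hemb.exists_measurable_extend measurable_id fun _ => this
  refine ⟨α.map (embeddingReal 𝒳), φ, Measure.isProbabilityMeasure_map hemb.measurable.aemeasurable,
    hφ, ?_⟩
  rw [Measure.map_map hφ hemb.measurable, hφe, Measure.map_id]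

/-- **Strong functional representation lemma** (Theorem 1, general case).
For any pair of random variables `(X,Y)` over Polish spaces with Borel probability measure and
`I(X;Y) < ∞`, there exists (possibly on an extension of the probability space preserving the
joint law of `(X,Y)`) a random variable `Z` independent of `X` such that `Y` is almost surely
a measurable function of `(X,Z)` and `I(X;Z|Y) ≤ log₂(I(X;Y)+1) + 4` bits. -/
theorem strong_functional_representation_lemma
    {Ω 𝒳 𝒴 : Type*} [MeasurableSpace Ω]
    [TopologicalSpace 𝒳] [PolishSpace 𝒳] [MeasurableSpace 𝒳] [BorelSpace 𝒳]
    [TopologicalSpace 𝒴] [PolishSpace 𝒴] [MeasurableSpace 𝒴] [BorelSpace 𝒴]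
    (μ : Measure Ω) [IsProbabilityMeasure μ]
    (X : Ω → 𝒳) (Y : Ω → 𝒴) (hX : Measurable X) (hY : Measurable Y)
    (hfin : miBits μ X Y ≠ ⊤) :
    ∃ (Ω' : Type) (_ : MeasurableSpace Ω') (μ' : Measure Ω') (_ : IsProbabilityMeasure μ')
      (𝒵 : Type) (_ : MeasurableSpace 𝒵)
      (X' : Ω' → 𝒳) (Y' : Ω' → 𝒴) (Z : Ω' → 𝒵),
      Measurable X' ∧ Measurable Y' ∧ Measurable Z ∧
      -- (X',Y') has the same joint law as (X,Y)
      μ'.map (fun ω => (X' ω, Y' ω)) = μ.map (fun ω => (X ω, Y ω)) ∧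
      -- Z is independent of X
      IndepFun X' Z μ' ∧
      -- Y is a.s. a measurable function of (X,Z)
      (∃ g : 𝒳 × 𝒵 → 𝒴, Measurable g ∧ Y' =ᵐ[μ'] fun ω => g (X' ω, Z ω)) ∧
      -- I(X;Z|Y) ≤ log₂(I(X;Y)+1) + 4
      cmiBits μ' X' Z Y' ≤
        ENNReal.ofReal (Real.logb 2 ((miBits μ X Y).toReal + 1) + 4) := by
  have hXY : Measurable fun ω => (X ω, Y ω) := hX.prodMk hY
  have : IsProbabilityMeasure (μ.map X) := Measure.isProbabilityMeasure_map hX.aemeasurable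
  have : IsProbabilityMeasure (μ.map Y) := Measure.isProbabilityMeasure_map hY.aemeasurable
  have : IsProbabilityMeasure (μ.map fun ω => (X ω, Y ω)) :=
    Measure.isProbabilityMeasure_map hXY.aemeasurable
  obtain ⟨hac, hlogint⟩ : (μ.map fun ω => (X ω, Y ω)) ≪ (μ.map X).prod (μ.map Y) ∧
      Integrable (fun x => Real.logb 2 ((μ.map fun ω => (X ω, Y ω)).rnDeriv
        ((μ.map X).prod (μ.map Y)) x).toReal) (μ.map fun ω => (X ω, Y ω)) := by
    by_contra h
    exact hfin (by unfold miBits klBits; rw [if_neg h])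
  have hmi : miBits μ X Y = ENNReal.ofReal (∫ x, Real.logb 2
      ((μ.map fun ω => (X ω, Y ω)).rnDeriv ((μ.map X).prod (μ.map Y)) x).toReal
      ∂(μ.map fun ω => (X ω, Y ω))) := by
    unfold miBits klBits; rw [if_pos ⟨hac, hlogint⟩]
  set I : ℝ := (miBits μ X Y).toReal with hI
  have hI0 : 0 ≤ I := ENNReal.toReal_nonneg
  have hIle : ∫ x, Real.logb 2 ((μ.map fun ω => (X ω, Y ω)).rnDeriv
      ((μ.map X).prod (μ.map Y)) x).toReal ∂(μ.map fun ω => (X ω, Y ω)) ≤ I := by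
    rw [hI, hmi, ENNReal.toReal_ofReal']
    exact le_max_left _ _
  obtain ⟨a, φ, _, hφ, haφ⟩ := exists_real_model (μ.map X)
  obtain ⟨b, χ, _, hχ, hbχ⟩ := exists_real_model (μ.map Y)
  have : IsProbabilityMeasure (volume.restrict (Set.Ico (0:ℝ) 1)) := ⟨by simp⟩
  set ν : Measure (ℝ × ℝ) := b.prod (volume.restrict (Set.Ico (0:ℝ) 1)) with hν
  have hνmap : ν.map (fun w => (χ w.1, w.2)) =
      (μ.map Y).prod (volume.restrict (Set.Ico (0:ℝ) 1)) := by
    have := Measure.map_prod_map b (volume.restrict (Set.Ico (0:ℝ) 1)) hχ measurable_id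
    rw [hbχ, Measure.map_id] at this
    exact this.symm
  have hfst : (μ.map fun ω => (X ω, Y ω)).map Prod.fst = μ.map X := by
    rw [Measure.map_map measurable_fst hXY]; rfl
  obtain ⟨g, hg, hlaw, hkl⟩ := sfrl_core (ν := ν) (η := fun w => χ w.1) (υ := Prod.snd)
    (hχ.comp measurable_fst) measurable_snd hνmap hfst hac hlogint hI0 hIle
  set ζ : Measure (ℕ → ℝ × ℝ) := Measure.infinitePi fun _ : ℕ => ν with hζ
  have hX' : Measurable fun ω : ℝ × (ℕ → ℝ × ℝ) => φ ω.1 := hφ.comp measurable_fst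
  have hXZ : Measurable fun ω : ℝ × (ℕ → ℝ × ℝ) => (φ ω.1, ω.2) := hX'.prodMk measurable_snd
  have hY' : Measurable fun ω : ℝ × (ℕ → ℝ × ℝ) => g (φ ω.1, ω.2) := hg.comp hXZ
  have hmapXZ : (a.prod ζ).map (fun ω => (φ ω.1, ω.2)) = (μ.map X).prod ζ := by
    have := Measure.map_prod_map a ζ hφ measurable_id
    rw [haφ, Measure.map_id] at this
    exact this.symm
  have hmX : (a.prod ζ).map (fun ω => φ ω.1) = μ.map X := by
    have e : (fun ω : ℝ × (ℕ → ℝ × ℝ) => φ ω.1) = φ ∘ Prod.fst := rfl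
    rw [e, ← Measure.map_map hφ measurable_fst, ← Measure.fst, Measure.fst_prod, haφ]
  have hjoint : (a.prod ζ).map (fun ω => (φ ω.1, g (φ ω.1, ω.2))) = μ.map fun ω => (X ω, Y ω) := by
    rw [← hlaw, ← hmapXZ, Measure.map_map (measurable_fst.prodMk hg) hXZ]; rfl
  have hmY : (a.prod ζ).map (fun ω => g (φ ω.1, ω.2)) = μ.map Y := by
    have := congrArg (fun m => m.map Prod.snd) hjoint
    beta_reduce at this
    rw [Measure.map_map measurable_snd (hX'.prodMk hY'), Measure.map_map measurable_snd hXY] at this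
    exact this
  refine ⟨ℝ × (ℕ → ℝ × ℝ), inferInstance, a.prod ζ, inferInstance, ℕ → ℝ × ℝ, inferInstance,
    fun ω => φ ω.1, fun ω => g (φ ω.1, ω.2), Prod.snd, hX', hY', measurable_snd, hjoint, ?_,
    ⟨g, hg, Filter.EventuallyEq.rfl⟩, ?_⟩
  · rw [indepFun_iff_map_prod_eq_prod_map_map hX'.aemeasurable measurable_snd.aemeasurable,
      hmapXZ, hmX, ← Measure.snd, Measure.snd_prod]
  · have h1 : miBits (a.prod ζ) (fun ω => φ ω.1) (fun ω => g (φ ω.1, ω.2)) = miBits μ X Y := by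
      unfold miBits; rw [hjoint, hmX, hmY]
    have h2 : miBits (a.prod ζ) (fun ω => φ ω.1) (fun ω => (ω.2, g (φ ω.1, ω.2))) ≤
        ENNReal.ofReal (I + (Real.logb 2 (I + 1) + 4)) := by
      have e1 : (a.prod ζ).map (fun ω => (φ ω.1, (ω.2, g (φ ω.1, ω.2)))) =
          ((μ.map X).prod ζ).map fun p => (p.1, (p.2, g p)) := by
        rw [← hmapXZ, Measure.map_map (measurable_fst.prodMk (measurable_snd.prodMk hg)) hXZ]; rfl
      have e2 : (a.prod ζ).map (fun ω => (ω.2, g (φ ω.1, ω.2))) =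
          ((μ.map X).prod ζ).map fun p => (p.2, g p) := by
        rw [← hmapXZ, Measure.map_map (measurable_snd.prodMk hg) hXZ]; rfl
      unfold miBits
      rw [e1, e2, hmX]
      exact hkl
    unfold cmiBits
    rw [h1, tsub_le_iff_right]
    refine h2.trans ?_
    have hlog : 0 ≤ Real.logb 2 (I + 1) := Real.logb_nonneg (by norm_num) (by linarith)
    rw [add_comm I, ENNReal.ofReal_add (by linarith) hI0, hI, ENNReal.ofReal_toReal hfin]
end
end

section
/- For any pair of jointly distributed discrete random variables X ∈ 𝒳 and Y ∈ 𝒴 with finite alphabets, there exists a discrete random variable Z with alphabet size |𝒵| ≤ |𝒳|(|𝒴|−1) + 2 such that Z is independent of X, Y is a function of (X,Z), and I(X;Z|Y) ≤ log₂(I(X;Y)+1) + 4 bits. -/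
open MeasureTheory ProbabilityTheory Real
open scoped ENNReal

noncomputable section
/-- The standard exponential law. -/
def nuE : Measure ℝ :=
  (volume.restrict (Set.Ioi 0)).withDensity (fun t => ENNReal.ofReal (Real.exp (-t)))

lemma nuE_lintegral (G : ℝ → ℝ≥0∞) (hG : Measurable G) :
    ∫⁻ t, G t ∂nuE = ∫⁻ t in Set.Ioi 0, ENNReal.ofReal (Real.exp (-t)) * G t := by
  unfold nuE
  rw [lintegral_withDensity_eq_lintegral_mul _ (by fun_prop) hG]
  rfl

lemma nuE_Ioi (s : ℝ) (hs : 0 ≤ s) : nuE (Set.Ioi s) = ENNReal.ofReal (Real.exp (-s)) := by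
  unfold nuE
  rw [withDensity_apply _ measurableSet_Ioi, Measure.restrict_restrict measurableSet_Ioi,
    Set.inter_eq_left.2 (Set.Ioi_subset_Ioi hs),
    ← ofReal_integral_eq_lintegral_ofReal]
  · rw [integral_exp_neg_Ioi]
  · exact integrableOn_exp_neg_Ioi s
  · exact Filter.Eventually.of_forall fun t => (Real.exp_pos _).le

lemma nuE_pos_ae : ∀ᵐ t ∂nuE, 0 < t := by
  unfold nuE
  exact (withDensity_absolutelyContinuous _ _).ae_le (ae_restrict_mem measurableSet_Ioi)

instance nuE_prob : IsProbabilityMeasure nuE := by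
  constructor
  have h := nuE_Ioi 0 le_rfl
  have h2 : nuE (Set.Ioi 0) = nuE Set.univ := by
    apply measure_congr
    filter_upwards [nuE_pos_ae] with t ht
    exact propext ⟨fun _ => trivial, fun _ => ht⟩
  rw [← h2, h]; simp

lemma lint_exp (k : ℝ) (hk : 0 < k) :
    ∫⁻ t in Set.Ioi (0:ℝ), ENNReal.ofReal (Real.exp (-(t / k))) = ENNReal.ofReal k := by
  have h := integrableOn_rpow_mul_exp_neg_mul_rpow (p := 1) (s := 0) (b := 1/k) (by norm_num) (by norm_num) (by positivity)
  have h2 := Real.integral_rpow_mul_exp_neg_mul_Ioi (a := 1) (r := 1/k) (by norm_num) (by positivity)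
  have e : ∀ t : ℝ, -(1/k) * t = -(t/k) := fun t => by ring
  have e' : ∀ t : ℝ, -(1/k * t) = -(t/k) := fun t => by ring
  simp only [Real.rpow_zero, Real.rpow_one, one_mul, e] at h
  simp only [sub_self, Real.rpow_zero, Real.rpow_one, one_mul, e', Real.Gamma_one, mul_one, one_div_one_div] at h2
  rw [← ofReal_integral_eq_lintegral_ofReal h, h2]
  exact Filter.Eventually.of_forall fun t => (Real.exp_pos _).le

lemma lint_t_exp (k : ℝ) (hk : 0 < k) :
    ∫⁻ t in Set.Ioi (0:ℝ), ENNReal.ofReal (Real.exp (-(t / k))) * ENNReal.ofReal t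
      = ENNReal.ofReal (k * k) := by
  have h := integrableOn_rpow_mul_exp_neg_mul_rpow (p := 1) (s := 1) (b := 1/k) (by norm_num) (by norm_num) (by positivity)
  have h2 := Real.integral_rpow_mul_exp_neg_mul_Ioi (a := 2) (r := 1/k) (by norm_num) (by positivity)
  have e : ∀ t : ℝ, -(1/k) * t = -(t/k) := fun t => by ring
  have e' : ∀ t : ℝ, -(1/k * t) = -(t/k) := fun t => by ring
  have e3 : (2:ℝ) - 1 = 1 := by norm_num
  simp only [Real.rpow_one, e] at h
  simp only [e3, Real.rpow_one, e', Real.Gamma_two, mul_one, one_div_one_div, Real.rpow_two] at h2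
  have : ∀ t : ℝ, ENNReal.ofReal (Real.exp (-(t / k))) * ENNReal.ofReal t
     = ENNReal.ofReal (t * Real.exp (-(t/k))) := fun t => by
    rw [mul_comm, ENNReal.ofReal_mul' (Real.exp_pos _).le]
  simp_rw [this]
  rw [← ofReal_integral_eq_lintegral_ofReal h, h2, sq]
  filter_upwards [ae_restrict_mem measurableSet_Ioi] with t ht
  exact mul_nonneg (le_of_lt ht) (Real.exp_pos _).le

/-- power weight -/
lemma nuE_weight (ρ b : ℝ) (hρ : 0 < ρ) (hb : 0 < b) :
    ∫⁻ t, ENNReal.ofReal ((1 + t / ρ) ^ (-(1 + 1 / b))) ∂nuE ≤ ENNReal.ofReal (ρ * b) := by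
  rw [nuE_lintegral _ (by fun_prop)]
  have hd : ∀ x ∈ Set.Ici (0:ℝ), HasDerivAt (fun t => -(ρ * b) * (1 + t / ρ) ^ (-(1/b)))
      ((1 + x / ρ) ^ (-(1 + 1 / b))) x := by
    intro x hx
    have hx' : 0 < 1 + x / ρ := by have : (0:ℝ) ≤ x := hx; positivity
    have h1 : HasDerivAt (fun t : ℝ => 1 + t / ρ) (1 / ρ) x :=
      ((hasDerivAt_id x).div_const ρ).const_add 1
    have h2 := (h1.rpow_const (p := -(1/b)) (Or.inl hx'.ne')).const_mul (-(ρ*b))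
    convert! h2 using 1
    have : -(1/b) - 1 = -(1+1/b) := by ring
    rw [this]; field_simp
  have hpos : ∀ x ∈ Set.Ioi (0:ℝ), 0 ≤ (1 + x / ρ) ^ (-(1 + 1 / b)) := by
    intro x hx
    have : (0:ℝ) < x := hx
    positivity
  have hlim : Filter.Tendsto (fun t => -(ρ * b) * (1 + t / ρ) ^ (-(1/b))) Filter.atTop (nhds 0) := by
    have h1 : Filter.Tendsto (fun t : ℝ => 1 + t / ρ) Filter.atTop Filter.atTop :=
      Filter.tendsto_atTop_add_const_left _ _ (Filter.tendsto_id.atTop_div_const hρ)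
    have h2 := ((tendsto_rpow_neg_atTop (y := 1/b) (by positivity)).comp h1).const_mul (-(ρ*b))
    simpa using h2
  have hi := integrableOn_Ioi_deriv_of_nonneg' hd hpos hlim
  have hv := integral_Ioi_of_hasDerivAt_of_nonneg' hd hpos hlim
  calc _ ≤ ∫⁻ t in Set.Ioi (0:ℝ), ENNReal.ofReal ((1 + t / ρ) ^ (-(1 + 1 / b))) := by
        apply setLIntegral_mono (by fun_prop)
        intro t ht
        have : ENNReal.ofReal (Real.exp (-t)) ≤ 1 := by
          rw [ENNReal.ofReal_le_one]; exact Real.exp_le_one_iff.2 (by simpa using le_of_lt ht)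
        calc _ ≤ 1 * ENNReal.ofReal ((1 + t / ρ) ^ (-(1 + 1 / b))) := by gcongr
          _ = _ := one_mul _
    _ = ENNReal.ofReal (ρ * b) := by
        rw [← ofReal_integral_eq_lintegral_ofReal hi, hv]
        · simp
        · filter_upwards [ae_restrict_mem measurableSet_Ioi] with t ht using hpos t ht
    _ ≤ _ := le_rfl

/-- Splitting off one coordinate of a product measure. -/
lemma pi_split {Y : Type*} [Fintype Y] [DecidableEq Y] (ν : Measure ℝ) [IsProbabilityMeasure ν]
    (y : Y) : Measure.pi (fun _ : Y => ν) =
      ((Measure.pi (fun _ : Y => ν)).prod ν).map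
        (fun p : (Y → ℝ) × ℝ => Function.update p.1 y p.2) := by
  apply Measure.pi_eq
  intro s hs
  rw [Measure.map_apply measurable_update' (MeasurableSet.univ_pi hs)]
  have : (fun p : (Y → ℝ) × ℝ => Function.update p.1 y p.2) ⁻¹' (Set.pi Set.univ s)
      = (Set.pi Set.univ (Function.update s y Set.univ)) ×ˢ (s y) := by
    ext ⟨V, t⟩
    simp only [Set.mem_preimage, Set.mem_pi, Set.mem_univ, true_imp_iff, Set.mem_prod]
    constructor
    · intro h
      refine ⟨fun i => ?_, by simpa using h y⟩
      by_cases hi : i = y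
      · subst hi; simp
      · simpa [hi] using h i
    · rintro ⟨h, h'⟩ i
      by_cases hi : i = y
      · subst hi; simpa using h'
      · simpa [hi] using h i
  rw [this, Measure.prod_prod, Measure.pi_pi, ← Finset.mul_prod_erase _ _ (Finset.mem_univ y),
    ← Finset.mul_prod_erase _ (fun i => ν (s i)) (Finset.mem_univ y)]
  simp only [Function.update_self, measure_univ, one_mul]
  rw [mul_comm]
  congr 1
  apply Finset.prod_congr rfl
  intro i hi
  rw [Function.update_of_ne (Finset.ne_of_mem_erase hi)]

/-- The event that `y` wins the exponential race with rates `k`. -/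
def winSet {Y : Type*} (k : Y → ℝ) (y : Y) : Set (Y → ℝ) :=
  {E | ∀ y', y' ≠ y → E y * k y' < E y' * k y}

lemma winSet_meas {Y : Type*} [Fintype Y] (k : Y → ℝ) (y : Y) : MeasurableSet (winSet k y) := by
  unfold winSet
  have : {E : Y → ℝ | ∀ y', y' ≠ y → E y * k y' < E y' * k y}
    = ⋂ y', ⋂ (_ : y' ≠ y), {E | E y * k y' < E y' * k y} := by ext; simp
  rw [this]
  refine MeasurableSet.iInter fun y' => MeasurableSet.iInter fun _ => ?_
  exact measurableSet_lt (by fun_prop) (by fun_prop)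

lemma win_lintegral {Y : Type*} [Fintype Y] [DecidableEq Y] (k : Y → ℝ) (hk0 : ∀ y, 0 ≤ k y)
    (hk1 : ∑ y, k y = 1) (y : Y) (hy : 0 < k y) (G : ℝ → ℝ≥0∞) (hG : Measurable G) :
    ∫⁻ E in winSet k y, G (E y) ∂(Measure.pi (fun _ : Y => nuE)) =
      ∫⁻ t in Set.Ioi 0, ENNReal.ofReal (Real.exp (-(t / k y))) * G t := by
  have hm := winSet_meas k y
  have hGm : Measurable ((winSet k y).indicator (fun E : Y → ℝ => G (E y))) :=
    (hG.comp (measurable_pi_apply y)).indicator hm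
  have hGm2 : Measurable (fun p : (Y → ℝ) × ℝ =>
      (winSet k y).indicator (fun E : Y → ℝ => G (E y)) (Function.update p.1 y p.2)) :=
    hGm.comp measurable_update'
  rw [← lintegral_indicator hm, pi_split nuE y, lintegral_map
    hGm measurable_update', lintegral_prod_symm,
    nuE_lintegral]
  · apply setLIntegral_congr_fun measurableSet_Ioi
    intro t ht
    have ht : 0 < t := ht
    have hs : ∀ V : Y → ℝ, (winSet k y).indicator (fun E => G (E y)) (Function.update V y t)
        = (Set.pi Set.univ (fun y' => if y' = y then Set.univ else Set.Ioi (t * k y' / k y))).indicator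
          (fun _ => G t) V := by
      intro V
      have : Function.update V y t ∈ winSet k y ↔
        V ∈ (Set.pi Set.univ (fun y' => if y' = y then Set.univ else Set.Ioi (t * k y' / k y))) := by
        simp only [winSet, Set.mem_ofPred_eq, Set.mem_pi, Set.mem_univ, true_imp_iff]
        refine forall_congr' fun y' => ?_
        by_cases h : y' = y
        · simp [h]
        · simp [h, div_lt_iff₀ hy]
      by_cases h : Function.update V y t ∈ winSet k y
      · rw [Set.indicator_of_mem h, Set.indicator_of_mem (this.1 h)]; simp
      · rw [Set.indicator_of_notMem h, Set.indicator_of_notMem (fun h' => h (this.2 h'))]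
    simp only [hs]
    rw [lintegral_indicator, setLIntegral_const, Measure.pi_pi,
      ← Finset.mul_prod_erase _ _ (Finset.mem_univ y)]
    · have : ∀ y' ∈ Finset.univ.erase y, nuE (if y' = y then Set.univ else Set.Ioi (t * k y' / k y))
          = ENNReal.ofReal (Real.exp (-(t * k y' / k y))) := by
        intro y' hy'
        rw [if_neg (Finset.ne_of_mem_erase hy')]
        have := hk0 y'
        exact nuE_Ioi _ (by positivity)
      rw [Finset.prod_congr rfl this, ← ENNReal.ofReal_prod_of_nonneg (fun _ _ => (Real.exp_pos _).le),
        ← Real.exp_sum]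
      simp only [if_true, measure_univ, one_mul]
      rw [mul_comm (G t), ← mul_assoc, ← ENNReal.ofReal_mul (Real.exp_pos _).le, ← Real.exp_add]
      congr 3
      have h3 : ∑ y' ∈ Finset.univ.erase y, k y' = 1 - k y := by
        rw [← hk1, ← Finset.add_sum_erase _ _ (Finset.mem_univ y)]; ring
      have h4 : ∑ y' ∈ Finset.univ.erase y, -(t * k y' / k y) = - (t / k y) * ∑ y' ∈ Finset.univ.erase y, k y' := by
        rw [Finset.mul_sum]; exact Finset.sum_congr rfl fun _ _ => by ring
      rw [h4, h3]; field_simp; ring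
    · refine MeasurableSet.univ_pi fun y' => ?_
      split_ifs
      · exact MeasurableSet.univ
      · exact measurableSet_Ioi
  · exact Measurable.lintegral_prod_left' hGm2
  · exact hGm2.aemeasurable

lemma race_pos_ae {Y : Type*} [Fintype Y] :
    ∀ᵐ E ∂(Measure.pi (fun _ : Y => nuE)), ∀ y, 0 < E y := by
  rw [ae_all_iff]
  intro y
  exact (measurePreserving_eval (fun _ : Y => nuE) y).quasiMeasurePreserving.ae nuE_pos_ae

lemma win_pos {Y : Type*} [Fintype Y] (k : Y → ℝ) (hk0 : ∀ y, 0 ≤ k y)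
    (hk1 : ∑ y, k y = 1) (E : Y → ℝ) (hE : ∀ y, 0 < E y) (y : Y) (h : E ∈ winSet k y) :
    0 < k y := by
  by_contra hc
  have h0 : k y = 0 := le_antisymm (not_lt.1 hc) (hk0 y)
  have : ∃ y', k y' ≠ 0 := by
    by_contra hn
    push Not at hn
    simp [hn] at hk1
  obtain ⟨y', hy'⟩ := this
  have hne : y' ≠ y := fun e => hy' (e ▸ h0)
  have h1 := h y' hne
  rw [h0, mul_zero] at h1
  have := mul_nonneg (hE y).le (hk0 y')
  linarith

lemma win_measure {Y : Type*} [Fintype Y] [DecidableEq Y] (k : Y → ℝ) (hk0 : ∀ y, 0 ≤ k y)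
    (hk1 : ∑ y, k y = 1) (y : Y) :
    (Measure.pi (fun _ : Y => nuE)) (winSet k y) = ENNReal.ofReal (k y) := by
  rcases (hk0 y).lt_or_eq with h | h
  · have h1 := win_lintegral k hk0 hk1 y h (fun _ => 1) measurable_const
    simp only [mul_one, lint_exp _ h] at h1
    simpa using h1
  · rw [← h]
    simp only [ENNReal.ofReal_zero]
    rw [measure_eq_zero_iff_ae_notMem]
    filter_upwards [race_pos_ae] with E hE hE2
    have := win_pos k hk0 hk1 E hE y hE2
    linarith

lemma win_disj {Y : Type*} (k : Y → ℝ) : Pairwise (fun y y' => Disjoint (winSet k y) (winSet k y')) := by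
  intro y y' hne
  rw [Set.disjoint_left]
  intro E h h'
  have h1 := h y' hne.symm
  have h2 := h' y hne
  linarith

lemma win_ae {Y : Type*} [Fintype Y] [DecidableEq Y] (k : Y → ℝ) (hk0 : ∀ y, 0 ≤ k y)
    (hk1 : ∑ y, k y = 1) :
    ∀ᵐ E ∂(Measure.pi (fun _ : Y => nuE)), ∃ y, E ∈ winSet k y := by
  have h : (Measure.pi (fun _ : Y => nuE)) (⋃ y, winSet k y) = 1 := by
    rw [measure_iUnion (win_disj k) (winSet_meas k), tsum_fintype]
    simp_rw [win_measure k hk0 hk1]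
    rw [← ENNReal.ofReal_sum_of_nonneg (fun y _ => hk0 y), hk1, ENNReal.ofReal_one]
  have h2 := (prob_compl_eq_zero_iff (MeasurableSet.iUnion (winSet_meas k))).2 h
  rw [← mem_ae_iff] at h2
  filter_upwards [h2] with E hE
  simpa using hE

lemma win_int {Y : Type*} [Fintype Y] [DecidableEq Y] (k : Y → ℝ) (hk0 : ∀ y, 0 ≤ k y)
    (hk1 : ∑ y, k y = 1) (y : Y) (hy : 0 < k y) :
    IntegrableOn (fun E : Y → ℝ => E y) (winSet k y) (Measure.pi (fun _ : Y => nuE)) ∧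
    ∫ E in winSet k y, E y ∂(Measure.pi (fun _ : Y => nuE)) = k y * k y := by
  have h1 := win_lintegral k hk0 hk1 y hy (fun t => ENNReal.ofReal t) (by fun_prop)
  rw [lint_t_exp _ hy] at h1
  have hp : ∀ᵐ E ∂((Measure.pi (fun _ : Y => nuE)).restrict (winSet k y)), 0 ≤ E y :=
    ae_restrict_of_ae (race_pos_ae.mono fun E hE => (hE y).le)
  have hm : AEStronglyMeasurable (fun E : Y → ℝ => E y) 
     ((Measure.pi (fun _ : Y => nuE)).restrict (winSet k y)) :=
    (measurable_pi_apply y).aestronglyMeasurable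
  constructor
  · refine ⟨hm, ?_⟩
    rw [hasFiniteIntegral_iff_ofReal hp, h1]
    exact ENNReal.ofReal_lt_top
  · rw [integral_eq_lintegral_of_nonneg_ae hp hm, h1, ENNReal.toReal_ofReal (by positivity)]

/-- law of `f(X)` -/
def pushm {X Y : Type*} [Fintype X] [DecidableEq Y] (p : X → ℝ) (f : X → Y) (y : Y) : ℝ :=
  ∑ x, if f x = y then p x else 0

/-- entropy of `f(X)` in nats -/
def Hc {X Y : Type*} [Fintype X] [DecidableEq Y] (p : X → ℝ) (f : X → Y) : ℝ :=
  ∑ x, p x * (-Real.log (pushm p f (f x)))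

lemma pushm_nonneg {X Y : Type*} [Fintype X] [DecidableEq Y] (p : X → ℝ) (hp : ∀ x, 0 ≤ p x)
    (f : X → Y) (y : Y) : 0 ≤ pushm p f y :=
  Finset.sum_nonneg fun x _ => by split_ifs; exacts [hp x, le_rfl]

lemma le_pushm {X Y : Type*} [Fintype X] [DecidableEq Y] (p : X → ℝ) (hp : ∀ x, 0 ≤ p x)
    (f : X → Y) (x : X) : p x ≤ pushm p f (f x) := by
  have := Finset.single_le_sum (f := fun x' => if f x' = f x then p x' else 0)
    (fun x' _ => by split_ifs; exacts [hp x', le_rfl]) (Finset.mem_univ x)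
  simpa [pushm] using this

lemma gibbs {X Y : Type*} [Fintype X] [Fintype Y] [DecidableEq Y] (p : X → ℝ)
    (hp : ∀ x, 0 ≤ p x) (hp1 : ∑ x, p x = 1) (f : X → Y) (w : Y → ℝ) (hw : ∀ y, 0 < w y)
    [Nonempty Y] :
    Hc p f ≤ ∑ x, p x * (-Real.log (w (f x))) + Real.log (∑ y, w y) := by
  set S := ∑ y, w y with hS
  have hSpos : 0 < S := Finset.sum_pos (fun y _ => hw y) Finset.univ_nonempty
  have key : ∀ x, p x * (-Real.log (pushm p f (f x))) ≤
      p x * (-Real.log (w (f x))) + p x * Real.log S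
        + (p x * (w (f x) / (S * pushm p f (f x))) - p x) := by
    intro x
    rcases (hp x).lt_or_eq with h | h
    · have hm : 0 < pushm p f (f x) := lt_of_lt_of_le h (le_pushm p hp f x)
      have h1 := Real.log_le_sub_one_of_pos (x := w (f x) / (S * pushm p f (f x)))
        (div_pos (hw _) (by positivity))
      rw [Real.log_div (hw _).ne' (by positivity), Real.log_mul hSpos.ne' hm.ne'] at h1
      nlinarith
    · simp [← h]
  have h2 : ∑ x, p x * (w (f x) / (S * pushm p f (f x))) ≤ 1 := by
    have e1 : ∀ x, p x * (w (f x) / (S * pushm p f (f x))) =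
        ∑ y, (if f x = y then p x else 0) * (w y / (S * pushm p f y)) := by
      intro x; simp
    simp_rw [e1]
    rw [Finset.sum_comm]
    simp_rw [← Finset.sum_mul]
    have : ∀ y, (∑ x, if f x = y then p x else 0) * (w y / (S * pushm p f y)) ≤ w y / S := by
      intro y
      change pushm p f y * _ ≤ _
      rcases (pushm_nonneg p hp f y).lt_or_eq with h | h
      · apply le_of_eq; field_simp
      · rw [← h]; have := hw y; simp; positivity
    calc _ ≤ ∑ y, w y / S := Finset.sum_le_sum fun y _ => this y
      _ = 1 := by rw [← Finset.sum_div, ← hS, div_self hSpos.ne']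
  calc Hc p f ≤ ∑ x, (p x * (-Real.log (w (f x))) + p x * Real.log S
        + (p x * (w (f x) / (S * pushm p f (f x))) - p x)) := Finset.sum_le_sum fun x _ => key x
    _ = ∑ x, p x * (-Real.log (w (f x))) + Real.log S
        + (∑ x, p x * (w (f x) / (S * pushm p f (f x))) - 1) := by
      rw [Finset.sum_add_distrib, Finset.sum_add_distrib, Finset.sum_sub_distrib, hp1,
        ← Finset.sum_mul, hp1, one_mul]
    _ ≤ _ := by linarith

/-- Comparison of `E log (1 + k/ρ)` with the mutual information. -/
lemma rho_bound {X Y : Type*} [Fintype X] [Fintype Y] (p : X → ℝ)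
    (hp : ∀ x, 0 ≤ p x) (hp1 : ∑ x, p x = 1) (k : X → Y → ℝ) (hk0 : ∀ x y, 0 ≤ k x y)
    (hk1 : ∀ x, ∑ y, k x y = 1) (ρ : Y → ℝ) (hρ : ∀ y, 0 < ρ y)
    (hρ2 : ∀ y, (∑ x, p x * k x y) / 2 ≤ ρ y) :
    ∑ x, ∑ y, p x * k x y * Real.log (1 + k x y / ρ y) ≤
      ∑ x, ∑ y, p x * k x y * Real.log (k x y / ∑ x', p x' * k x' y) + Real.log 3 := by
  set m : Y → ℝ := fun y => ∑ x', p x' * k x' y with hm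
  have hm0 : ∀ y, 0 ≤ m y := fun y => Finset.sum_nonneg fun x _ => mul_nonneg (hp x) (hk0 x y)
  have hm1 : ∑ y, m y = 1 := by
    simp only [hm]; rw [Finset.sum_comm]; simp_rw [← Finset.mul_sum, hk1, mul_one, hp1]
  have key : ∀ x y, p x * k x y * Real.log (1 + k x y / ρ y) ≤
      p x * k x y * Real.log (k x y / m y) + p x * k x y * Real.log 3
        + (p x * m y - p x * k x y) / 3 := by
    intro x y
    rcases (mul_nonneg (hp x) (hk0 x y)).lt_or_eq with h | h
    · have hpx : 0 < p x := (hp x).lt_of_ne (by rintro e; simp [← e] at h)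
      have hkx : 0 < k x y := (hk0 x y).lt_of_ne (by rintro e; simp [← e] at h)
      have hmy : 0 < m y := lt_of_lt_of_le h
        (Finset.single_le_sum (f := fun x' => p x' * k x' y)
          (fun x' _ => mul_nonneg (hp x') (hk0 x' y)) (Finset.mem_univ x))
      have h1 : Real.log (1 + k x y / ρ y) ≤
          Real.log (k x y / m y) + Real.log 3 + (m y / k x y - 1) / 3 := by
        have ha : Real.log (1 + k x y / ρ y) ≤ Real.log ((k x y / m y) * 3 * ((2 + m y / k x y) / 3)) := by
          apply Real.log_le_log (by have := hρ y; positivity)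
          have : k x y / ρ y ≤ k x y / (m y / 2) := by
            have := hρ2 y
            gcongr
          calc 1 + k x y / ρ y ≤ 1 + k x y / (m y / 2) := by linarith
            _ = _ := by field_simp; ring
        rw [Real.log_mul (by positivity) (by positivity), Real.log_mul (by positivity) (by positivity)] at ha
        have hb := Real.log_le_sub_one_of_pos (x := (2 + m y / k x y) / 3) (by positivity)
        linarith
      calc _ ≤ p x * k x y * (Real.log (k x y / m y) + Real.log 3 + (m y / k x y - 1) / 3) := by gcongr
        _ = _ := by field_simp
    · rw [← h]; have := mul_nonneg (hp x) (hm0 y); simp; positivity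
  calc _ ≤ ∑ x, ∑ y, (p x * k x y * Real.log (k x y / m y) + p x * k x y * Real.log 3
        + (p x * m y - p x * k x y) / 3) :=
        Finset.sum_le_sum fun x _ => Finset.sum_le_sum fun y _ => key x y
    _ = _ := by
      simp_rw [Finset.sum_add_distrib, ← Finset.sum_mul, ← Finset.sum_div, Finset.sum_sub_distrib,
        ← Finset.mul_sum, hk1, hm1, mul_one, hp1]
      simp [hm]

lemma weight_int {Y : Type*} [Fintype Y] (y : Y) (ρ b : ℝ) (hρ : 0 < ρ) (hb : 0 < b) :
    Integrable (fun E : Y → ℝ => (1 + E y / ρ) ^ (-(1 + 1 / b))) (Measure.pi (fun _ : Y => nuE)) ∧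
    ∫ E : Y → ℝ, (1 + E y / ρ) ^ (-(1 + 1 / b)) ∂(Measure.pi (fun _ : Y => nuE)) ≤ ρ * b := by
  have h0 : ∫⁻ E : Y → ℝ, ENNReal.ofReal ((1 + E y / ρ) ^ (-(1 + 1 / b))) ∂(Measure.pi (fun _ : Y => nuE))
      ≤ ENNReal.ofReal (ρ * b) := by
    rw [(measurePreserving_eval (fun _ : Y => nuE) y).lintegral_comp
      (f := fun t => ENNReal.ofReal ((1 + t / ρ) ^ (-(1 + 1 / b)))) (by fun_prop)]
    exact nuE_weight ρ b hρ hb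
  have hp : ∀ᵐ E ∂(Measure.pi (fun _ : Y => nuE)), 0 ≤ (1 + E y / ρ) ^ (-(1 + 1 / b)) := by
    filter_upwards [race_pos_ae] with E hE
    have := hE y
    positivity
  have hm : AEStronglyMeasurable (fun E : Y → ℝ => (1 + E y / ρ) ^ (-(1 + 1 / b)))
      (Measure.pi (fun _ : Y => nuE)) :=
    Measurable.aestronglyMeasurable (by fun_prop)
  constructor
  · refine ⟨hm, ?_⟩
    rw [hasFiniteIntegral_iff_ofReal hp]
    exact lt_of_le_of_lt h0 ENNReal.ofReal_lt_top
  · rw [integral_eq_lintegral_of_nonneg_ae hp hm]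
    exact ENNReal.toReal_le_of_le_ofReal (by positivity) h0

lemma win_affine {Y : Type*} [Fintype Y] [DecidableEq Y] (k : Y → ℝ) (hk0 : ∀ y, 0 ≤ k y)
    (hk1 : ∑ y, k y = 1) (y : Y) (A c : ℝ) :
    Integrable ((winSet k y).indicator (fun E : Y → ℝ => A + (E y / k y - 1) * c))
      (Measure.pi (fun _ : Y => nuE)) ∧
    ∫ E, (winSet k y).indicator (fun E : Y → ℝ => A + (E y / k y - 1) * c) E
      ∂(Measure.pi (fun _ : Y => nuE)) = k y * A := by
  have hmeas := win_measure k hk0 hk1 y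
  rw [integral_indicator (winSet_meas k y), integrable_indicator_iff (winSet_meas k y)]
  rcases (hk0 y).lt_or_eq with h | h
  · obtain ⟨hi, hv⟩ := win_int k hk0 hk1 y h
    have hc : ∀ a : ℝ, IntegrableOn (fun _ : Y → ℝ => a) (winSet k y) (Measure.pi (fun _ : Y => nuE)) :=
      fun a => integrableOn_const
    have e : (fun E : Y → ℝ => A + (E y / k y - 1) * c) = fun E => (A - c) + (c / k y) * E y := by
      funext E; field_simp; ring
    rw [e]
    refine ⟨(hc _).add (hi.const_mul _), ?_⟩
    rw [integral_add (hc _) (hi.const_mul _), integral_const_mul, hv, setIntegral_const,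
      Measure.real, hmeas, ENNReal.toReal_ofReal h.le, smul_eq_mul]
    field_simp; ring
  · rw [← h, ENNReal.ofReal_zero] at hmeas
    rw [IntegrableOn, Measure.restrict_eq_zero.2 hmeas]
    simp [← h]

lemma core {X Y : Type*} [Fintype X] [Fintype Y] [DecidableEq X] [DecidableEq Y] [Nonempty Y] (p : X → ℝ)
    (hp : ∀ x, 0 ≤ p x) (hp1 : ∑ x, p x = 1) (k : X → Y → ℝ) (hk0 : ∀ x y, 0 ≤ k x y)
    (hk1 : ∀ x, ∑ y, k x y = 1) (I : ℝ) (hI0 : 0 ≤ I)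
    (hI : ∑ x, ∑ y, p x * k x y * Real.log (k x y / ∑ x', p x' * k x' y) ≤ I * Real.log 2) :
    ∃ q : (X → Y) → ℝ, (∀ f, 0 ≤ q f) ∧ ∑ f, q f = 1 ∧
      (∀ x y, (∑ f, q f * if f x = y then 1 else 0) = k x y) ∧
      ∑ f, q f * Hc p f ≤
        ∑ x, ∑ y, p x * k x y * Real.log (k x y / ∑ x', p x' * k x' y)
          + (Real.log (I + 1) + 4 * Real.log 2) := by
  classical
  letI : MeasurableSpace Y := ⊤
  haveI : DiscreteMeasurableSpace Y := ⟨fun _ => trivial⟩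
  set J := ∑ x, ∑ y, p x * k x y * Real.log (k x y / ∑ x', p x' * k x' y) with hJ
  set P := Measure.pi (fun _ : Y => nuE) with hP
  obtain ⟨y0⟩ := ‹Nonempty Y›
  haveI : Nonempty Y := ⟨y0⟩
  set F : (Y → ℝ) → (X → Y) := fun E x =>
    if h : ∃ y, E ∈ winSet (k x) y then h.choose else y0 with hF
  have hFwin : ∀ E x y, E ∈ winSet (k x) y → F E x = y := by
    intro E x y h
    have hex : ∃ y, E ∈ winSet (k x) y := ⟨y, h⟩
    simp only [hF, dif_pos hex]
    by_contra hne
    exact Set.disjoint_left.1 (win_disj (k x) hne) hex.choose_spec h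
  have hFae : ∀ᵐ E ∂P, ∀ x, E ∈ winSet (k x) (F E x) := by
    rw [ae_all_iff]
    intro x
    filter_upwards [win_ae (k x) (hk0 x) (hk1 x)] with E ⟨y, hE⟩
    rw [hFwin E x y hE]; exact hE
  have hFm : Measurable F := by
    rw [measurable_pi_iff]
    intro x
    apply measurable_to_countable'
    intro y
    have : (fun E => F E x) ⁻¹' {y} = winSet (k x) y ∪
        ((⋃ y', winSet (k x) y')ᶜ ∩ {_E | y0 = y}) := by
      ext E
      simp only [Set.mem_preimage, Set.mem_singleton_iff, Set.mem_union, Set.mem_inter_iff,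
        Set.mem_compl_iff, Set.mem_iUnion, Set.mem_ofPred_eq]
      constructor
      · intro h
        by_cases hex : ∃ y, E ∈ winSet (k x) y
        · left
          have h2 := hex
          obtain ⟨y', hy'⟩ := h2
          rw [hFwin E x y' hy'] at h
          exact h ▸ hy'
        · right
          refine ⟨hex, ?_⟩
          simpa only [hF, dif_neg hex] using h
      · rintro (h | ⟨h, h'⟩)
        · exact hFwin E x y h
        · simpa only [hF, dif_neg h] using h'
    rw [this]
    exact (winSet_meas _ _).union (((MeasurableSet.iUnion (winSet_meas _)).compl).inter
      (MeasurableSet.const _))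
  haveI : IsProbabilityMeasure (P.map F) := Measure.isProbabilityMeasure_map hFm.aemeasurable
  have hq : ∀ G : (X → Y) → ℝ, ∑ f, (P.map F).real {f} * G f = ∫ E, G (F E) ∂P := by
    intro G
    rw [← integral_map hFm.aemeasurable (Measurable.of_discrete).aestronglyMeasurable,
      integral_fintype (Integrable.of_finite)]
    rfl
  refine ⟨fun f => (P.map F).real {f}, fun f => measureReal_nonneg, ?_, ?_, ?_⟩
  · have := hq (fun _ => 1)
    simpa using this
  · intro x y
    refine (hq (fun f => if f x = y then 1 else 0)).trans ?_
    have : (fun E => if F E x = y then (1:ℝ) else 0) =ᵐ[P] (winSet (k x) y).indicator (fun _ => 1) := by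
      filter_upwards [hFae] with E hE
      by_cases h : F E x = y
      · rw [if_pos h, Set.indicator_of_mem (h ▸ hE x)]
      · rw [if_neg h, Set.indicator_of_notMem (fun h' => h (hFwin E x y h'))]
    rw [integral_congr_ae this, integral_indicator (winSet_meas _ _), setIntegral_const,
      Measure.real, win_measure (k x) (hk0 x) (hk1 x), ENNReal.toReal_ofReal (hk0 x y)]
    simp
  · rw [hq (Hc p)]
    have hl2 : 0 < Real.log 2 := Real.log_pos (by norm_num)
    set b := 2 * Real.log 2 * (I + 1) with hb
    have hbpos : 0 < b := by positivity
    set n : ℝ := ((Fintype.card Y : ℕ) : ℝ) with hn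
    have hnpos : 0 < n := by rw [hn]; exact_mod_cast Fintype.card_pos
    set m : Y → ℝ := fun y => ∑ x', p x' * k x' y with hm
    have hm0 : ∀ y, 0 ≤ m y := fun y => Finset.sum_nonneg fun x _ => mul_nonneg (hp x) (hk0 x y)
    have hm1 : ∑ y, m y = 1 := by
      simp only [hm]; rw [Finset.sum_comm]; simp_rw [← Finset.mul_sum, hk1, mul_one, hp1]
    set ρ : Y → ℝ := fun y => m y / 2 + 1 / (2 * n) with hρd
    have hρ : ∀ y, 0 < ρ y := fun y => by have := hm0 y; simp only [hρd]; positivity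
    have hρ1 : ∑ y, ρ y = 1 := by
      simp only [hρd]
      rw [Finset.sum_add_distrib, ← Finset.sum_div, hm1, Finset.sum_const, Finset.card_univ,
        nsmul_eq_mul, ← hn]
      field_simp; norm_num
    have hL := rho_bound p hp hp1 k hk0 hk1 ρ hρ (fun y => by
      simp only [hρd, hm]; have : 0 < 1 / (2 * n) := by positivity
      linarith)
    rw [← hJ] at hL
    set L := ∑ x, ∑ y, p x * k x y * Real.log (1 + k x y / ρ y) with hLd
    set lam := 1 + 1 / b with hlam
    have hlampos : 0 < lam := by positivity
    set U : X → Y → (Y → ℝ) → ℝ := fun x y => (winSet (k x) y).indicator (fun E : Y → ℝ =>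
      Real.log (1 + k x y / ρ y) + (E y / k x y - 1) * ((k x y / ρ y) / (1 + k x y / ρ y))) with hU
    have hUi : ∀ x y, Integrable (U x y) P := fun x y => (win_affine (k x) (hk0 x) (hk1 x) y _ _).1
    have hUv : ∀ x y, ∫ E, U x y E ∂P = k x y * Real.log (1 + k x y / ρ y) :=
      fun x y => (win_affine (k x) (hk0 x) (hk1 x) y _ _).2
    have hW := fun y => weight_int y (ρ y) b (hρ y) hbpos
    have hpt : ∀ᵐ E ∂P, Hc p (F E) ≤ (∑ x, ∑ y, p x * lam * U x y E) +
        ((Real.log b - 1) + ∑ y, (1 / b) * (1 + E y / ρ y) ^ (-lam)) := by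
      filter_upwards [hFae, race_pos_ae] with E hE hpos
      have h1 : ∀ y, 0 < 1 + E y / ρ y := fun y => by
        have := hpos y; have := hρ y; positivity
      have hg := gibbs p hp hp1 (F E) (fun y => (1 + E y / ρ y) ^ (-lam))
        (fun y => Real.rpow_pos_of_pos (h1 y) _)
      have hSpos : 0 < ∑ y, (1 + E y / ρ y) ^ (-lam) :=
        Finset.sum_pos (fun y _ => Real.rpow_pos_of_pos (h1 y) _) Finset.univ_nonempty
      have hlog : Real.log (∑ y, (1 + E y / ρ y) ^ (-lam)) ≤
          (Real.log b - 1) + ∑ y, (1 / b) * (1 + E y / ρ y) ^ (-lam) := by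
        rw [← Finset.mul_sum]
        have := Real.log_le_sub_one_of_pos (div_pos hSpos hbpos)
        rw [Real.log_div hSpos.ne' hbpos.ne'] at this
        have e : (1 / b) * ∑ y, (1 + E y / ρ y) ^ (-lam) = (∑ y, (1 + E y / ρ y) ^ (-lam)) / b := by
          ring
        linarith
      have hx : ∀ x, p x * (-Real.log ((1 + E (F E x) / ρ (F E x)) ^ (-lam))) ≤
          ∑ y, p x * lam * U x y E := by
        intro x
        set y := F E x with hy
        have hEy : E ∈ winSet (k x) y := hE x
        rw [Finset.sum_eq_single y]
        · rw [Real.log_rpow (h1 _), neg_mul, neg_neg, mul_assoc]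
          apply mul_le_mul_of_nonneg_left _ (hp x)
          apply mul_le_mul_of_nonneg_left _ hlampos.le
          simp only [hU]
          rw [Set.indicator_of_mem hEy]
          have hk := win_pos (k x) (hk0 x) (hk1 x) E hpos y hEy
          have hr := hρ y
          have hz : 0 < 1 + k x y / ρ y := by positivity
          have := Real.log_le_sub_one_of_pos (div_pos (h1 y) hz)
          rw [Real.log_div (h1 y).ne' hz.ne'] at this
          have e : (1 + E y / ρ y) / (1 + k x y / ρ y) - 1 =
            (E y / k x y - 1) * ((k x y / ρ y) / (1 + k x y / ρ y)) := by
            field_simp; ring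
          linarith
        · intro y' _ hne
          have : U x y' E = 0 := by
            simp only [hU]
            exact Set.indicator_of_notMem (fun h' => hne (hFwin E x y' h').symm) _
          rw [this, mul_zero]
        · simp
      calc Hc p (F E) ≤ _ := hg
        _ ≤ _ := add_le_add (Finset.sum_le_sum fun x _ => hx x) hlog
    have hi1 : Integrable (fun E => ∑ x, ∑ y, p x * lam * U x y E) P :=
      integrable_finsetSum _ fun x _ => integrable_finsetSum _ fun y _ => (hUi x y).const_mul _
    have hi2 : Integrable (fun E : Y → ℝ => ∑ y, (1 / b) * (1 + E y / ρ y) ^ (-lam)) P :=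
      integrable_finsetSum _ fun y _ => (hW y).1.const_mul _
    have hi3 : Integrable (fun E : Y → ℝ => (Real.log b - 1) + ∑ y, (1 / b) * (1 + E y / ρ y) ^ (-lam)) P :=
      (integrable_const _).add hi2
    have hHi : Integrable (fun E => Hc p (F E)) P := by
      have : Integrable (Hc p) (P.map F) := Integrable.of_finite
      exact this.comp_measurable hFm
    have hS : ∫ E : Y → ℝ, ∑ y, (1 / b) * (1 + E y / ρ y) ^ (-lam) ∂P ≤ 1 := by
      rw [integral_finsetSum _ fun y _ => (hW y).1.const_mul _]
      calc _ ≤ ∑ y, ρ y := by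
            apply Finset.sum_le_sum
            intro y _
            rw [integral_const_mul]
            calc (1 / b) * _ ≤ (1 / b) * (ρ y * b) := by
                  apply mul_le_mul_of_nonneg_left (hW y).2; positivity
              _ = ρ y := by field_simp
        _ = 1 := hρ1
    have hT : ∫ E, ∑ x, ∑ y, p x * lam * U x y E ∂P = lam * L := by
      rw [integral_finsetSum _ fun x _ => integrable_finsetSum _ fun y _ => (hUi x y).const_mul _]
      rw [hLd, Finset.mul_sum]
      apply Finset.sum_congr rfl
      intro x _
      rw [integral_finsetSum _ fun y _ => (hUi x y).const_mul _, Finset.mul_sum]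
      apply Finset.sum_congr rfl
      intro y _
      rw [integral_const_mul, hUv]
      ring
    have hfin : ∫ E, Hc p (F E) ∂P ≤ lam * L + Real.log b := by
      calc _ ≤ ∫ E, ((∑ x, ∑ y, p x * lam * U x y E) +
        ((Real.log b - 1) + ∑ y, (1 / b) * (1 + E y / ρ y) ^ (-lam))) ∂P :=
            integral_mono_ae hHi (hi1.add hi3) hpt
        _ = lam * L + ((Real.log b - 1) + ∫ E : Y → ℝ, ∑ y, (1 / b) * (1 + E y / ρ y) ^ (-lam) ∂P) := by
            rw [integral_add hi1 hi3, hT, integral_add (integrable_const _) hi2, integral_const]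
            simp
        _ ≤ _ := by linarith
    have hl3 : Real.log 3 ≤ 2 * Real.log 2 := by
      have : 2 * Real.log 2 = Real.log 4 := by
        rw [show (4:ℝ) = 2 ^ 2 by norm_num, Real.log_pow]; norm_num
      rw [this]; exact Real.log_le_log (by norm_num) (by norm_num)
    have hLb : L ≤ b := by
      have : b = 2 * (I * Real.log 2) + 2 * Real.log 2 := by rw [hb]; ring
      have := mul_nonneg hI0 hl2.le
      linarith
    have h5 : lam * L ≤ L + 1 := by
      have : L / b ≤ 1 := (div_le_one hbpos).2 hLb
      have e : lam * L = L + L / b := by rw [hlam]; ring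
      linarith
    have h6 : Real.log b = Real.log (2 * Real.log 2) + Real.log (I + 1) := by
      rw [hb, Real.log_mul (by positivity) (by positivity)]
    have h7 := Real.log_le_sub_one_of_pos (x := 2 * Real.log 2) (by positivity)
    linarith

lemma reduce {X Y : Type*} [Fintype X] [Fintype Y] [DecidableEq X] [DecidableEq Y] [Nonempty Y]
    (H : (X → Y) → ℝ) (q : (X → Y) → ℝ) (hq0 : ∀ f, 0 ≤ q f) (hq1 : ∑ f, q f = 1) :
    ∃ (n : ℕ) (g : Fin n → (X → Y)) (w : Fin n → ℝ),
      n ≤ Fintype.card X * (Fintype.card Y - 1) + 2 ∧ (∀ i, 0 < w i) ∧ ∑ i, w i = 1 ∧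
      (∀ x y, (∑ i, w i * if g i x = y then 1 else 0) = ∑ f, q f * if f x = y then 1 else 0) ∧
      ∑ i, w i * H (g i) = ∑ f, q f * H f := by
  classical
  obtain ⟨y0⟩ := ‹Nonempty Y›
  let v : (X → Y) → (X × {y : Y // y ≠ y0} → ℝ) × ℝ := fun f =>
    (fun a => if f a.1 = a.2.1 then 1 else 0, H f)
  have hmem : ∑ f, q f • v f ∈ convexHull ℝ (Set.range v) :=
    (convex_convexHull ℝ _).sum_mem (fun f _ => hq0 f) hq1
      (fun f _ => subset_convexHull ℝ _ ⟨f, rfl⟩)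
  obtain ⟨ι, hι, z, w, hz, haff, hw0, hw1, hwz⟩ := eq_pos_convex_span_of_mem_convexHull hmem
  have hz' : ∀ i, ∃ f, v f = z i := fun i => hz ⟨i, rfl⟩
  choose g hg using hz'
  have hsum : ∑ i, w i • v (g i) = ∑ f, q f • v f := by
    rw [← hwz]; exact Finset.sum_congr rfl fun i _ => by rw [hg]
  have h2 : ∑ i, w i * H (g i) = ∑ f, q f * H f := by
    have := congrArg Prod.snd hsum
    simpa [Prod.snd_sum, v] using this
  have h1 : ∀ x y, y ≠ y0 → (∑ i, w i * if g i x = y then 1 else 0) = ∑ f, q f * if f x = y then 1 else 0 := by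
    intro x y hy
    have := congrFun (congrArg Prod.fst hsum) (x, ⟨y, hy⟩)
    simpa [Prod.fst_sum, v, Finset.sum_apply] using this
  have h3 : ∀ x, (∑ i, w i * if g i x = y0 then 1 else 0) = ∑ f, q f * if f x = y0 then 1 else 0 := by
    intro x
    have ha : ∑ y, (∑ i, w i * if g i x = y then (1:ℝ) else 0) = 1 := by
      rw [Finset.sum_comm]; simp [hw1]
    have hb : ∑ y, (∑ f, q f * if f x = y then (1:ℝ) else 0) = 1 := by
      rw [Finset.sum_comm]; simp [hq1]
    rw [← Finset.add_sum_erase _ _ (Finset.mem_univ y0)] at ha hb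
    rw [Finset.sum_congr rfl (fun y hy => h1 x y (Finset.ne_of_mem_erase hy))] at ha
    linarith
  have hcard : Fintype.card ι ≤ Fintype.card X * (Fintype.card Y - 1) + 2 := by
    have hc := haff.card_le_finrank_succ
    have hc2 := Submodule.finrank_le (vectorSpan ℝ (Set.range z))
    have hc3 : Module.finrank ℝ ((X × {y : Y // y ≠ y0} → ℝ) × ℝ) =
        Fintype.card X * (Fintype.card Y - 1) + 1 := by
      rw [Module.finrank_prod, Module.finrank_fintype_fun_eq_card, Module.finrank_self,
        Fintype.card_prod, Fintype.card_subtype_compl, Fintype.card_subtype_eq]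
    omega
  let e := (Fintype.equivFin ι).symm
  refine ⟨Fintype.card ι, fun i => g (e i), fun i => w (e i), hcard, fun i => hw0 _, ?_, ?_, ?_⟩
  · rw [← hw1]; exact e.sum_comp w
  · intro x y
    rw [e.sum_comp (fun i => w i * if g i x = y then (1:ℝ) else 0)]
    by_cases hy : y = y0
    · rw [hy]; exact h3 x
    · exact h1 x y hy
  · rw [← h2]; exact e.sum_comp (fun i => w i * H (g i))

lemma klBits_finite {α : Type*} [Fintype α] [MeasurableSpace α] [MeasurableSingletonClass α]
    (P Q : Measure α) [IsFiniteMeasure P] [IsFiniteMeasure Q] (h : P ≪ Q) :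
    klBits P Q = ENNReal.ofReal (∑ a, P.real {a} * Real.logb 2 (P.real {a} / Q.real {a})) := by
  unfold klBits
  rw [if_pos ⟨h, Integrable.of_finite⟩, integral_fintype Integrable.of_finite]
  congr 1
  apply Finset.sum_congr rfl
  intro a _
  rw [smul_eq_mul]
  by_cases hQ : Q {a} = 0
  · simp [Measure.real, h hQ]
  · have h1 := Measure.setLIntegral_rnDeriv h {a}
    rw [lintegral_singleton] at h1
    have h2 : P.real {a} = (P.rnDeriv Q a).toReal * Q.real {a} := by
      rw [Measure.real, ← h1, ENNReal.toReal_mul]; rfl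
    have h3 : Q.real {a} ≠ 0 := by
      rw [Measure.real]; exact ENNReal.toReal_ne_zero.2 ⟨hQ, measure_ne_top _ _⟩
    have h4 : P.real {a} / Q.real {a} = (P.rnDeriv Q a).toReal := by rw [h2]; field_simp
    rw [h4]

lemma miBits_finite {Ω A B : Type*} [MeasurableSpace Ω]
    [Fintype A] [MeasurableSpace A] [MeasurableSingletonClass A]
    [Fintype B] [MeasurableSpace B] [MeasurableSingletonClass B]
    (μ : Measure Ω) [IsProbabilityMeasure μ] (X : Ω → A) (Y : Ω → B)
    (hX : Measurable X) (hY : Measurable Y) :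
    miBits μ X Y = ENNReal.ofReal (∑ a, ∑ b, (μ.map (fun ω => (X ω, Y ω))).real {(a, b)} *
      Real.logb 2 ((μ.map (fun ω => (X ω, Y ω))).real {(a, b)} /
        ((μ.map X).real {a} * (μ.map Y).real {b}))) := by
  unfold miBits
  have hXY : Measurable (fun ω => (X ω, Y ω)) := hX.prodMk hY
  rw [klBits_finite]
  · rw [Fintype.sum_prod_type]
    refine congrArg _ (Finset.sum_congr rfl fun a _ => Finset.sum_congr rfl fun b _ => ?_)
    rw [← Set.singleton_prod_singleton, measureReal_prod_prod]
  · have hs : ∀ s : Set (A × B), s = ⋃ a ∈ s, {a} := fun s => by simp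
    intro s hs0
    rw [hs s, measure_biUnion_null_iff (Set.to_countable s)]
    rintro ⟨a, b⟩ hab
    have h0 : ((μ.map X).prod (μ.map Y)) {(a, b)} = 0 :=
      measure_mono_null (Set.singleton_subset_iff.2 hab) hs0
    rw [← Set.singleton_prod_singleton, Measure.prod_prod, mul_eq_zero,
      Measure.map_apply hX (measurableSet_singleton _),
      Measure.map_apply hY (measurableSet_singleton _)] at h0
    rw [Measure.map_apply hXY (measurableSet_singleton _)]
    rcases h0 with h0 | h0
    · refine measure_mono_null ?_ h0
      intro ω hω
      simp only [Set.mem_preimage, Set.mem_singleton_iff, Prod.mk.injEq] at hω ⊢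
      exact hω.1
    · refine measure_mono_null ?_ h0
      intro ω hω
      simp only [Set.mem_preimage, Set.mem_singleton_iff, Prod.mk.injEq] at hω ⊢
      exact hω.2

lemma map_real_sum {Ω A : Type*} [Fintype Ω] [MeasurableSpace Ω] [MeasurableSingletonClass Ω]
    [MeasurableSpace A] [MeasurableSingletonClass A] [DecidableEq A]
    (μ : Measure Ω) [IsFiniteMeasure μ] (T : Ω → A) (a : A) :
    (μ.map T).real {a} = ∑ ω, μ.real {ω} * if T ω = a then 1 else 0 := by
  rw [map_measureReal_apply (measurable_of_finite T) (measurableSet_singleton _)]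
  have h := integral_indicator_one (μ := μ) (s := T ⁻¹' {a}) (Set.toFinite _).measurableSet
  rw [← h, integral_fintype Integrable.of_finite]
  refine Finset.sum_congr rfl fun ω _ => ?_
  by_cases hT : T ω = a
  · rw [Set.indicator_of_mem (show ω ∈ T ⁻¹' {a} from hT), if_pos hT]; simp
  · rw [Set.indicator_of_notMem (show ω ∉ T ⁻¹' {a} from hT), if_neg hT]; simp

lemma miBits_congr {Ω Ω' A B : Type*} [MeasurableSpace Ω] [MeasurableSpace Ω']
    [MeasurableSpace A] [MeasurableSpace B] (μ : Measure Ω) (μ' : Measure Ω')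
    (X : Ω → A) (Y : Ω → B) (X' : Ω' → A) (Y' : Ω' → B) (hX : Measurable X) (hY : Measurable Y)
    (hX' : Measurable X') (hY' : Measurable Y')
    (h : μ'.map (fun ω => (X' ω, Y' ω)) = μ.map (fun ω => (X ω, Y ω))) :
    miBits μ' X' Y' = miBits μ X Y := by
  have h1 : μ'.map X' = μ.map X := by
    have := congrArg (Measure.map Prod.fst) h
    rwa [Measure.map_map measurable_fst (hX'.prodMk hY'), Measure.map_map measurable_fst (hX.prodMk hY)] at this
  have h2 : μ'.map Y' = μ.map Y := by
    have := congrArg (Measure.map Prod.snd) h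
    rwa [Measure.map_map measurable_snd (hX'.prodMk hY'), Measure.map_map measurable_snd (hX.prodMk hY)] at this
  unfold miBits
  rw [h, h1, h2]

lemma sum_space {𝒳 A : Type*} [Fintype 𝒳] {N n : ℕ} (μ1 : Measure (Fin N)) (μ2 : Measure (Fin n))
    [IsProbabilityMeasure μ1] [IsProbabilityMeasure μ2] (p : 𝒳 → ℝ) (w : Fin n → ℝ)
    (e : 𝒳 ≃ Fin N) (h12r : ∀ a b, (μ1.prod μ2).real {(a, b)} = p (e.symm a) * w b)
    [MeasurableSpace A] [MeasurableSingletonClass A] [DecidableEq A]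
    (T : Fin N × Fin n → A) (a : A) :
    ((μ1.prod μ2).map T).real {a} =
      ∑ x, ∑ z, p x * w z * if T (e x, z) = a then 1 else 0 := by
  rw [map_real_sum, Fintype.sum_prod_type, ← e.sum_comp]
  simp_rw [h12r, Equiv.symm_apply_apply]

/-- **Strong functional representation lemma, finite-alphabet case with cardinality bound**
(Theorem 1, discrete case). For discrete `X ∈ 𝒳`, `Y ∈ 𝒴` with finite alphabets there is a
random variable `Z` on an alphabet of size at most `|𝒳|(|𝒴|-1)+2`, independent of `X`, such
that `Y` is a.s. a function of `(X,Z)` and `I(X;Z|Y) ≤ log₂(I(X;Y)+1)+4` bits. -/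
theorem strong_functional_representation_lemma_finite
    {Ω 𝒳 𝒴 : Type*} [MeasurableSpace Ω]
    [Fintype 𝒳] [MeasurableSpace 𝒳] [MeasurableSingletonClass 𝒳]
    [Fintype 𝒴] [MeasurableSpace 𝒴] [MeasurableSingletonClass 𝒴]
    (μ : Measure Ω) [IsProbabilityMeasure μ]
    (X : Ω → 𝒳) (Y : Ω → 𝒴) (hX : Measurable X) (hY : Measurable Y) :
    ∃ (Ω' : Type) (_ : MeasurableSpace Ω') (μ' : Measure Ω') (_ : IsProbabilityMeasure μ')
      (𝒵 : Type) (_ : Fintype 𝒵) (_ : MeasurableSpace 𝒵) (_ : MeasurableSingletonClass 𝒵)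
      (X' : Ω' → 𝒳) (Y' : Ω' → 𝒴) (Z : Ω' → 𝒵),
      -- cardinality bound |𝒵| ≤ |𝒳|(|𝒴|-1) + 2
      Fintype.card 𝒵 ≤ Fintype.card 𝒳 * (Fintype.card 𝒴 - 1) + 2 ∧
      Measurable X' ∧ Measurable Y' ∧ Measurable Z ∧
      -- (X',Y') has the same joint law as (X,Y)
      μ'.map (fun ω => (X' ω, Y' ω)) = μ.map (fun ω => (X ω, Y ω)) ∧
      -- Z is independent of X
      IndepFun X' Z μ' ∧
      -- Y is a.s. a function of (X,Z)
      (∃ g : 𝒳 × 𝒵 → 𝒴, Y' =ᵐ[μ'] fun ω => g (X' ω, Z ω)) ∧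
      -- I(X;Z|Y) ≤ log₂(I(X;Y)+1) + 4
      cmiBits μ' X' Z Y' ≤
        ENNReal.ofReal (Real.logb 2 ((miBits μ X Y).toReal + 1) + 4) := by
  classical
  have hXY : Measurable (fun ω => (X ω, Y ω)) := hX.prodMk hY
  haveI hPX : IsProbabilityMeasure (μ.map X) := Measure.isProbabilityMeasure_map hX.aemeasurable
  haveI hPY : IsProbabilityMeasure (μ.map Y) := Measure.isProbabilityMeasure_map hY.aemeasurable
  haveI hPXY : IsProbabilityMeasure (μ.map (fun ω => (X ω, Y ω))) :=
    Measure.isProbabilityMeasure_map hXY.aemeasurable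
  obtain ⟨ω0⟩ : Nonempty Ω := nonempty_of_isProbabilityMeasure μ
  haveI : Nonempty 𝒴 := ⟨Y ω0⟩
  set p : 𝒳 → ℝ := fun x => (μ.map X).real {x} with hpdef
  set j : 𝒳 → 𝒴 → ℝ := fun x y => (μ.map (fun ω => (X ω, Y ω))).real {(x, y)} with hjdef
  have hp0 : ∀ x, 0 ≤ p x := fun x => measureReal_nonneg
  have hj0 : ∀ x y, 0 ≤ j x y := fun x y => measureReal_nonneg
  have hsum1 : ∀ {A : Type _} [Fintype A] [MeasurableSpace A] [MeasurableSingletonClass A]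
      (ν : Measure A) [IsProbabilityMeasure ν], ∑ a, ν.real {a} = 1 := by
    intro A _ _ _ ν _
    have := integral_fintype (μ := ν) (f := fun _ => (1:ℝ)) Integrable.of_finite
    simpa using this.symm
  have hp1 : ∑ x, p x = 1 := hsum1 _
  have hjx : ∀ x, ∑ y, j x y = p x := by
    intro x
    have e : μ.map X = (μ.map (fun ω => (X ω, Y ω))).map Prod.fst := by
      rw [Measure.map_map measurable_fst hXY]; rfl
    simp only [hpdef]
    rw [e, map_real_sum, Fintype.sum_prod_type, Finset.sum_eq_single x]
    · simp [hjdef]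
    · intro x' _ hne; simp [hne]
    · simp
  have hjy : ∀ y, ∑ x, j x y = (μ.map Y).real {y} := by
    intro y
    have e : μ.map Y = (μ.map (fun ω => (X ω, Y ω))).map Prod.snd := by
      rw [Measure.map_map measurable_snd hXY]; rfl
    rw [e, map_real_sum, Fintype.sum_prod_type]
    simp [hjdef]
  have hjle : ∀ x y, j x y ≤ p x := fun x y => by
    rw [← hjx]; exact Finset.single_le_sum (fun y' _ => hj0 x y') (Finset.mem_univ y)
  set k : 𝒳 → 𝒴 → ℝ := fun x y => if p x = 0 then 1 / (Fintype.card 𝒴 : ℝ) else j x y / p x with hkdef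
  have hk0 : ∀ x y, 0 ≤ k x y := by
    intro x y
    simp only [hkdef]
    split_ifs
    · positivity
    · exact div_nonneg (hj0 x y) (hp0 x)
  have hk1 : ∀ x, ∑ y, k x y = 1 := by
    intro x
    simp only [hkdef]
    split_ifs with h
    · simp
    · rw [← Finset.sum_div, hjx, div_self h]
  have hpk : ∀ x y, p x * k x y = j x y := by
    intro x y
    simp only [hkdef]
    split_ifs with h
    · rw [h, zero_mul]; exact le_antisymm (hj0 x y) (h ▸ hjle x y)
    · field_simp
  set J := ∑ x, ∑ y, p x * k x y * Real.log (k x y / ∑ x', p x' * k x' y) with hJ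
  have hl2 : 0 < Real.log 2 := Real.log_pos (by norm_num)
  have hMI : miBits μ X Y = ENNReal.ofReal (J / Real.log 2) := by
    rw [miBits_finite μ X Y hX hY, hJ, Finset.sum_div]
    refine congrArg _ (Finset.sum_congr rfl fun x _ => ?_)
    rw [Finset.sum_div]
    refine Finset.sum_congr rfl fun y _ => ?_
    change j x y * Real.logb 2 (j x y / (p x * (μ.map Y).real {y})) = _
    have e : ∑ x', p x' * k x' y = (μ.map Y).real {y} := by
      rw [← hjy]; exact Finset.sum_congr rfl fun x' _ => hpk x' y
    rw [e, hpk, Real.logb, mul_div_assoc]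
    by_cases h : p x = 0
    · have : j x y = 0 := le_antisymm (h ▸ hjle x y) (hj0 x y)
      rw [this]; simp
    · have : k x y = j x y / p x := by simp only [hkdef]; rw [if_neg h]
      rw [this, div_div]
  set I := (miBits μ X Y).toReal with hI
  have hI0 : 0 ≤ I := ENNReal.toReal_nonneg
  have hJI : J ≤ I * Real.log 2 := by
    rw [← div_le_iff₀ hl2, hI, hMI, ENNReal.toReal_ofReal']
    exact le_max_left _ _
  obtain ⟨q, hq0, hq1, hqk, hqH⟩ := core p hp0 hp1 k hk0 hk1 I hI0 hJI
  obtain ⟨n, g, w, hn, hw0, hw1, hwk, hwH⟩ := reduce (Hc p) q hq0 hq1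
  -- the new probability space
  set e : 𝒳 ≃ Fin (Fintype.card 𝒳) := Fintype.equivFin 𝒳 with hedef
  have hem : Measurable e := measurable_of_finite _
  set μ1 : Measure (Fin (Fintype.card 𝒳)) := (μ.map X).map e with hμ1
  haveI : IsProbabilityMeasure μ1 := Measure.isProbabilityMeasure_map hem.aemeasurable
  set μ2 : Measure (Fin n) := ∑ i, ENNReal.ofReal (w i) • Measure.dirac i with hμ2
  haveI : IsProbabilityMeasure μ2 := by
    constructor
    rw [hμ2, Measure.finsetSum_apply]
    simp only [Measure.smul_apply, measure_univ, smul_eq_mul, mul_one]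
    rw [← ENNReal.ofReal_sum_of_nonneg fun i _ => (hw0 i).le, hw1, ENNReal.ofReal_one]
  have h1r : ∀ i, μ1.real {i} = p (e.symm i) := by
    intro i
    rw [hμ1, map_measureReal_apply hem (measurableSet_singleton _)]
    simp only [hpdef]
    congr 1
    ext x
    simp [Equiv.eq_symm_apply]
  have h2r : ∀ i, μ2.real {i} = w i := by
    intro i
    rw [Measure.real, hμ2, Measure.finsetSum_apply]
    simp only [Measure.smul_apply, smul_eq_mul, MeasurableSpace.measurableSet_top,
      Measure.dirac_apply' _ (measurableSet_singleton i)]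
    rw [Finset.sum_eq_single i]
    · simp [(hw0 i).le]
    · intro b _ hb; simp [hb]
    · simp
  have h12r : ∀ a b, (μ1.prod μ2).real {(a, b)} = p (e.symm a) * w b := by
    intro a b
    rw [← Set.singleton_prod_singleton, measureReal_prod_prod, h1r, h2r]
  set X' : Fin (Fintype.card 𝒳) × Fin n → 𝒳 := fun ω => e.symm ω.1 with hX'
  set Z : Fin (Fintype.card 𝒳) × Fin n → Fin n := fun ω => ω.2 with hZ
  set Y' : Fin (Fintype.card 𝒳) × Fin n → 𝒴 := fun ω => g ω.2 (e.symm ω.1) with hY'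
  have hX'm : Measurable X' := measurable_of_finite _
  have hY'm : Measurable Y' := measurable_of_finite _
  have hZm : Measurable Z := measurable_of_finite _
  -- sums over the new space
  have hlawX : ∀ x, ((μ1.prod μ2).map X').real {x} = p x := by
    intro x
    rw [sum_space μ1 μ2 p w e h12r]
    simp only [hX', Equiv.symm_apply_apply]
    simp_rw [← Finset.sum_mul, ← Finset.mul_sum, hw1]
    simp
  have hlawXY : (μ1.prod μ2).map (fun ω => (X' ω, Y' ω)) = μ.map (fun ω => (X ω, Y ω)) := by
    haveI : IsProbabilityMeasure ((μ1.prod μ2).map (fun ω => (X' ω, Y' ω))) :=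
      Measure.isProbabilityMeasure_map (hX'm.prodMk hY'm).aemeasurable
    refine Measure.ext_of_singleton fun a => ?_
    obtain ⟨x, y⟩ := a
    have : ((μ1.prod μ2).map (fun ω => (X' ω, Y' ω))).real {(x, y)} = j x y := by
      rw [sum_space μ1 μ2 p w e h12r]
      simp only [hX', hY', Equiv.symm_apply_apply, Prod.mk.injEq]
      rw [Finset.sum_eq_single x]
      · simp only [true_and, mul_assoc]
        rw [← Finset.mul_sum, hwk, hqk, hpk]
      · intro x' _ hne; simp [hne]
      · simp
    exact (ENNReal.toReal_eq_toReal_iff' (measure_ne_top _ _) (measure_ne_top _ _)).1 this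
  have hlawZY : ∀ z y, ((μ1.prod μ2).map (fun ω => (Z ω, Y' ω))).real {(z, y)}
      = w z * pushm p (g z) y := by
    intro z y
    rw [sum_space μ1 μ2 p w e h12r, pushm, Finset.mul_sum]
    refine Finset.sum_congr rfl fun x _ => ?_
    simp only [hZ, hY', Equiv.symm_apply_apply, Prod.mk.injEq]
    rw [Finset.sum_eq_single z]
    · by_cases h : g z x = y
      · simp [h, mul_comm]
      · simp [h]
    · intro z' _ hne; simp [hne]
    · simp
  have hlawXZY : ∀ x z y, ((μ1.prod μ2).map (fun ω => (X' ω, (Z ω, Y' ω)))).real {(x, (z, y))}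
      = p x * w z * if g z x = y then 1 else 0 := by
    intro x z y
    rw [sum_space μ1 μ2 p w e h12r, Finset.sum_eq_single x]
    · simp only [hX', hZ, hY', Equiv.symm_apply_apply, Prod.mk.injEq, true_and]
      rw [Finset.sum_eq_single z]
      · simp
      · intro z' _ hne; simp [hne]
      · simp
    · intro x' _ hne; simp [hX', hne]
    · simp
  have hMI2 : miBits (μ1.prod μ2) X' (fun ω => (Z ω, Y' ω)) =
      ENNReal.ofReal ((∑ i, w i * Hc p (g i)) / Real.log 2) := by
    rw [miBits_finite _ _ _ hX'm (hZm.prodMk hY'm)]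
    congr 1
    have : ∀ x, ∑ b : Fin n × 𝒴, ((μ1.prod μ2).map (fun ω => (X' ω, (Z ω, Y' ω)))).real {(x, b)} *
        Real.logb 2 (((μ1.prod μ2).map (fun ω => (X' ω, (Z ω, Y' ω)))).real {(x, b)} /
        (((μ1.prod μ2).map X').real {x} * ((μ1.prod μ2).map (fun ω => (Z ω, Y' ω))).real {b}))
        = ∑ z, w z * (p x * (-Real.log (pushm p (g z) (g z x)))) / Real.log 2 := by
      intro x
      rw [Fintype.sum_prod_type]
      refine Finset.sum_congr rfl fun z _ => ?_
      simp_rw [hlawXZY, hlawX, hlawZY]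
      rw [Finset.sum_eq_single (g z x)]
      · simp only [if_true, mul_one]
        by_cases h : p x = 0
        · simp [h]
        · have hw := (hw0 z).ne'
          have : p x * w z / (p x * (w z * pushm p (g z) (g z x))) = (pushm p (g z) (g z x))⁻¹ := by
            field_simp
          rw [this, Real.logb, Real.log_inv]
          ring
      · intro y _ hne; simp [hne.symm]
      · simp
    simp_rw [this]
    rw [Finset.sum_comm, Finset.sum_div]
    refine Finset.sum_congr rfl fun z _ => ?_
    rw [← Finset.sum_div, ← Finset.mul_sum]; rfl
  refine ⟨Fin (Fintype.card 𝒳) × Fin n, inferInstance, μ1.prod μ2, inferInstance, Fin n,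
    inferInstance, inferInstance, inferInstance, X', Y', Z, ?_, hX'm, hY'm, hZm, hlawXY, ?_, ?_, ?_⟩
  · simpa using hn
  · exact indepFun_prod (X := fun i => e.symm i) (Y := fun z : Fin n => z)
      (measurable_of_finite _) measurable_id
  · exact ⟨fun a => g a.2 a.1, Filter.EventuallyEq.rfl⟩
  · unfold cmiBits
    rw [miBits_congr μ (μ1.prod μ2) X Y X' Y' hX hY hX'm hY'm hlawXY, hMI2, hMI,
      tsub_le_iff_right]
    refine le_trans (ENNReal.ofReal_le_ofReal ?_) ENNReal.ofReal_add_le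
    rw [Real.logb, div_add' _ _ _ hl2.ne', ← add_div]
    gcongr
    rw [hwH]
    linarith
end
end
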